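/- Let E be a finite-dimensional real inner product space, E₀ ⊆ E a subspace, Q a symmetric bilinear form on E₀, τ > 0, and t ↦ R_t a continuous family of self-adjoint operators on E. Then the Morse index of the index form I on Ω([0,τ],E) is finite and equal to the sum of the multiplicities of the focal points for the operator J = d²/dt² + R_t and boundary condition (E₀, Q) contained in the open interval (0,τ). -/

import Mathlib

open scoped RealInnerProductSpace

variable {E : Type*} [NormedAddCommGroup E] [InnerProductSpace ℝ E]

/-- `f : ℝ → E` is continuous on `[a,b]` and piecewise `C^n` there, i.e. there is a
finite partition `a = s₀ < s₁ < ⋯ < s_k = b` such that `f` is `C^n` on each closed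
subinterval `[sᵢ, sᵢ₊₁]` (derivatives being taken one-sidedly at the endpoints). -/
def PiecewiseContDiffOn (n : ℕ) (f : ℝ → E) (a b : ℝ) : Prop :=
  ContinuousOn f (Set.Icc a b) ∧
  ∃ (k : ℕ) (s : Fin (k + 1) → ℝ), StrictMono s ∧ s 0 = a ∧ s (Fin.last k) = b ∧
    ∀ i : Fin k, ContDiffOn ℝ (n : ℕ∞) f (Set.Icc (s i.castSucc) (s i.succ))

/-- Membership in the space `Ω([0,τ],E)` of continuous piecewise `C²` curves
`v : [0,τ] → E` with `v 0 ∈ E₀`, `⟪v' 0, w⟫ = -Q (v 0) w` for all `w ∈ E₀`, and `v τ = 0`. -/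
def InOmega (E₀ : Submodule ℝ E) (Q : E →ₗ[ℝ] E →ₗ[ℝ] ℝ) (τ : ℝ) (v : ℝ → E) : Prop :=
  PiecewiseContDiffOn 2 v 0 τ ∧ v 0 ∈ E₀ ∧
  (∀ w ∈ E₀, ⟪derivWithin v (Set.Icc 0 τ) 0, w⟫ = -(Q (v 0) w)) ∧
  v τ = 0

/-- The index form `I(v) = -Q(v 0, v 0) + ∫₀^τ (⟪v', v'⟫ - ⟪R_t (v t), v t⟫) dt`. -/
noncomputable def indexForm (R : ℝ → E →L[ℝ] E) (Q : E →ₗ[ℝ] E →ₗ[ℝ] ℝ) (τ : ℝ)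
    (v : ℝ → E) : ℝ :=
  -(Q (v 0) (v 0)) + ∫ t in (0:ℝ)..τ,
    (⟪derivWithin v (Set.Icc 0 τ) t, derivWithin v (Set.Icc 0 τ) t⟫ - ⟪R t (v t), v t⟫)

/-- A `C²` curve `u : [0,a] → E` with `u'' + R_t u = 0` on `[0,a]`, `u 0 ∈ E₀`,
`⟪u' 0, w⟫ = -Q (u 0) w` for all `w ∈ E₀`, and `u a = 0`. -/
def IsFocalSolution (R : ℝ → E →L[ℝ] E) (E₀ : Submodule ℝ E) (Q : E →ₗ[ℝ] E →ₗ[ℝ] ℝ)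
    (a : ℝ) (u : ℝ → E) : Prop :=
  ContDiffOn ℝ 2 u (Set.Icc 0 a) ∧
  (∀ t ∈ Set.Icc 0 a,
    derivWithin (derivWithin u (Set.Icc 0 a)) (Set.Icc 0 a) t + R t (u t) = 0) ∧
  u 0 ∈ E₀ ∧
  (∀ w ∈ E₀, ⟪derivWithin u (Set.Icc 0 a) 0, w⟫ = -(Q (u 0) w)) ∧
  u a = 0

/-- `a ∈ (0,τ]` is a focal point for `J = d²/dt² + R_t` and boundary condition `(E₀, Q)`
if there is a nontrivial solution on `[0,a]`. -/
def IsFocalPoint (R : ℝ → E →L[ℝ] E) (E₀ : Submodule ℝ E) (Q : E →ₗ[ℝ] E →ₗ[ℝ] ℝ)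
    (τ a : ℝ) : Prop :=
  a ∈ Set.Ioc 0 τ ∧
  ∃ u : ℝ → E, IsFocalSolution R E₀ Q a u ∧ ∃ t ∈ Set.Icc 0 a, u t ≠ 0

/-- The multiplicity of a focal point: the maximal number of focal solutions on `[0,a]`
that are linearly independent as curves on `[0,a]`. -/
noncomputable def focalMultiplicity (R : ℝ → E →L[ℝ] E) (E₀ : Submodule ℝ E)
    (Q : E →ₗ[ℝ] E →ₗ[ℝ] ℝ) (a : ℝ) : ℕ :=
  sSup {n : ℕ | ∃ u : Fin n → ℝ → E,
    (∀ i, IsFocalSolution R E₀ Q a (u i)) ∧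
    ∀ c : Fin n → ℝ, (∀ t ∈ Set.Icc 0 a, (∑ i, c i • u i t) = 0) → c = 0}

/-- The set of `n` such that there are `n` elements of `Ω([0,τ],E)`, linearly independent
as curves on `[0,τ]`, on (the span of) which the index form is negative.  The Morse index
of the index form is the supremum of this set. -/
def MorseIndexSet (R : ℝ → E →L[ℝ] E) (E₀ : Submodule ℝ E) (Q : E →ₗ[ℝ] E →ₗ[ℝ] ℝ)
    (τ : ℝ) : Set ℕ :=
  {n | ∃ v : Fin n → ℝ → E,
    (∀ i, InOmega E₀ Q τ (v i)) ∧
    (∀ c : Fin n → ℝ, (∀ t ∈ Set.Icc 0 τ, (∑ i, c i • v i t) = 0) → c = 0) ∧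
    (∀ c : Fin n → ℝ, c ≠ 0 → indexForm R Q τ (fun t => ∑ i, c i • v i t) < 0)}

/-- `J = d²/dt² + R_t` is disconjugate on a set `s ⊆ ℝ`: no nontrivial `C²` solution of
`u'' + R_t u = 0` on `s` vanishes at two distinct points of `s`. -/
def DisconjugateOn (R : ℝ → E →L[ℝ] E) (s : Set ℝ) : Prop :=
  ∀ u : ℝ → E, ContDiffOn ℝ 2 u s →
    (∀ t ∈ s, derivWithin (derivWithin u s) s t + R t (u t) = 0) →
    ∀ s₁ ∈ s, ∀ s₂ ∈ s, s₁ ≠ s₂ → u s₁ = 0 → u s₂ = 0 → ∀ t ∈ s, u t = 0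

/-- `a < b` are mutually conjugate if there is a not-identically-zero `C²` solution of
`v'' + R_t v = 0` on `[a,b]` with `v a = v b = 0`. -/
def MutuallyConjugate (R : ℝ → E →L[ℝ] E) (a b : ℝ) : Prop :=
  a < b ∧ ∃ v : ℝ → E, ContDiffOn ℝ 2 v (Set.Icc a b) ∧
    (∀ t ∈ Set.Icc a b,
      derivWithin (derivWithin v (Set.Icc a b)) (Set.Icc a b) t + R t (v t) = 0) ∧
    v a = 0 ∧ v b = 0 ∧ ∃ t ∈ Set.Icc a b, v t ≠ 0

section FileA

open Set Filter Topology MeasureTheory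

theorem lin_ode_exists_aux {F : Type*} [NormedAddCommGroup F] [NormedSpace ℝ F] [CompleteSpace F]
    (A : ℝ → F →L[ℝ] F) (hA : Continuous A) (M : ℝ) (hM0 : 0 ≤ M) (hM : ∀ t, ‖A t‖ ≤ M)
    (x₀ : F) (n : ℕ) :
    ∃ X : ℝ → F, X 0 = x₀ ∧ ∀ t ∈ Icc (0:ℝ) (n * (1 / (2 * M + 2))),
      HasDerivWithinAt X (A t (X t)) (Icc (0:ℝ) (n * (1 / (2 * M + 2)))) t := by
  set h : ℝ := 1 / (2 * M + 2) with hh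
  have hpos : 0 < h := by positivity
  induction n with
  | zero =>
    refine ⟨fun _ => x₀, rfl, ?_⟩
    intro t ht
    simp only [Nat.cast_zero, zero_mul, Icc_self, mem_singleton_iff] at ht ⊢
    subst ht
    exact HasFDerivWithinAt.of_subsingleton subsingleton_singleton
  | succ n ih =>
    obtain ⟨X, hX0, hX⟩ := ih
    set b : ℝ := n * h with hb
    have hb0 : 0 ≤ b := by positivity
    have hbc : ((n + 1 : ℕ) : ℝ) * h = b + h := by push_cast; ring
    rw [hbc]
    have hpl : IsPicardLindelof (fun t x => A t x) (tmin := b) (tmax := b + h)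
        ⟨b, le_refl _, by linarith⟩ (X b) ‖X b‖₊ 0 (⟨M, hM0⟩ * (2 * ‖X b‖₊)) ⟨M, hM0⟩ := by
      constructor
      · intro t _
        apply LipschitzWith.lipschitzOnWith
        exact (A t).lipschitz.weaken (hM t)
      · intro x _
        exact (hA.clm_apply continuous_const).continuousOn
      · intro t _ x hx
        have h1 : ‖x‖ ≤ 2 * ‖X b‖ := by
          have := norm_le_norm_add_norm_sub' x (X b)
          rw [mem_closedBall_iff_norm] at hx
          simp only [coe_nnnorm] at hx
          linarith
        calc ‖A t x‖ ≤ ‖A t‖ * ‖x‖ := (A t).le_opNorm x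
          _ ≤ M * (2 * ‖X b‖) := by gcongr; exact hM t
      · simp only [add_sub_cancel_left, sub_self, NNReal.coe_zero, sub_zero, coe_nnnorm]
        rw [max_eq_left hpos.le]
        change M * (2 * ‖X b‖) * h ≤ ‖X b‖
        rw [hh, mul_one_div, div_le_iff₀ (by positivity)]
        nlinarith [norm_nonneg (X b)]
    obtain ⟨Y, hY0, hY⟩ := hpl.exists_eq_forall_mem_Icc_hasDerivWithinAt₀
    simp only at hY0
    have hZ1 : ∀ t ∈ Icc 0 b, (if t ≤ b then X t else Y t) = X t := fun t ht => if_pos ht.2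
    have hZ2 : ∀ t ∈ Icc b (b+h), (if t ≤ b then X t else Y t) = Y t := by
      intro t ht
      split_ifs with h1
      · have : t = b := le_antisymm h1 ht.1
        rw [this, hY0]
      · rfl
    refine ⟨fun t => if t ≤ b then X t else Y t, by simp [hb0, hX0], ?_⟩
    intro t ht
    rw [← Icc_union_Icc_eq_Icc hb0 (by linarith : b ≤ b + h)]
    apply HasDerivWithinAt.union
    · by_cases htb : t ≤ b
      · have ht' : t ∈ Icc 0 b := ⟨ht.1, htb⟩
        beta_reduce
        rw [hZ1 t ht']
        exact (hX t ht').congr hZ1 (hZ1 t ht')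
      · apply HasFDerivWithinAt.of_notMem_closure
        rw [isClosed_Icc.closure_eq]
        exact fun h => htb h.2
    · by_cases htb : b ≤ t
      · have ht' : t ∈ Icc b (b+h) := ⟨htb, ht.2⟩
        beta_reduce
        rw [hZ2 t ht']
        exact (hY t ht').congr hZ2 (hZ2 t ht')
      · apply HasFDerivWithinAt.of_notMem_closure
        rw [isClosed_Icc.closure_eq]
        exact fun h => htb h.1

theorem lin_ode_exists {F : Type*} [NormedAddCommGroup F] [NormedSpace ℝ F] [CompleteSpace F]
    (A : ℝ → F →L[ℝ] F) (hA : Continuous A) (M : ℝ) (hM0 : 0 ≤ M) (hM : ∀ t, ‖A t‖ ≤ M)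
    (x₀ : F) (T : ℝ) (hT : 0 ≤ T) :
    ∃ X : ℝ → F, X 0 = x₀ ∧ ∀ t ∈ Icc (0:ℝ) T, HasDerivAt X (A t (X t)) t := by
  have hpos : 0 < 1 / (2 * M + 2) := by positivity
  obtain ⟨n, hn⟩ := exists_nat_ge (T / (1 / (2 * M + 2)))
  rw [div_le_iff₀ hpos] at hn
  obtain ⟨X, hX0, hX⟩ := lin_ode_exists_aux A hA M hM0 hM x₀ n
  have hX' : ∀ t ∈ Icc (0:ℝ) T, HasDerivWithinAt X (A t (X t)) (Icc 0 T) t := fun t ht =>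
    (hX t ⟨ht.1, ht.2.trans hn⟩).mono (Icc_subset_Icc_right hn)
  have hXc : ContinuousOn X (Icc 0 T) := fun t ht => (hX' t ht).continuousWithinAt
  have hc : Continuous (fun s => A s (IccExtend hT ((Icc 0 T).domRestrict X) s)) :=
    hA.clm_apply (continuousOn_iff_continuous_domRestrict.1 hXc).Icc_extend'
  have hext : ∀ s ∈ Icc 0 T, IccExtend hT ((Icc 0 T).domRestrict X) s = X s := fun s hs => by
    rw [IccExtend_of_mem _ _ hs]; rfl
  have key : ∀ t ∈ Icc 0 T, x₀ + ∫ s in (0:ℝ)..t, A s (IccExtend hT ((Icc 0 T).domRestrict X) s)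
      = X t := by
    intro t ht
    have := intervalIntegral.integral_eq_sub_of_hasDerivAt_of_le ht.1
      (f := X) (f' := fun s => A s (IccExtend hT ((Icc 0 T).domRestrict X) s))
      (hXc.mono (Icc_subset_Icc_right ht.2)) (fun s hs => by
        have hs' : s ∈ Icc 0 T := ⟨hs.1.le, hs.2.le.trans ht.2⟩
        rw [hext s hs']
        exact (hX' s hs').hasDerivAt (Icc_mem_nhds hs.1 (hs.2.trans_le ht.2)))
      (hc.intervalIntegrable _ _)
    rw [this, hX0]; abel
  refine ⟨fun t => x₀ + ∫ s in (0:ℝ)..t, A s (IccExtend hT ((Icc 0 T).domRestrict X) s), by simp, ?_⟩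
  intro t ht
  beta_reduce
  rw [key t ht]
  have := (intervalIntegral.integral_hasDerivAt_right (hc.intervalIntegrable 0 t)
    (hc.stronglyMeasurableAtFilter _ _) hc.continuousAt).const_add x₀
  rwa [hext t ht] at this

end FileA

section FileB

open Set Filter Topology MeasureTheory

open scoped RealInnerProductSpace

section PartB

variable {E : Type*} [NormedAddCommGroup E] [InnerProductSpace ℝ E]

theorem ode_zero {R : ℝ → E →L[ℝ] E} {a b M : ℝ} (hM : 0 ≤ M) (hR : ∀ t ∈ Icc a b, ‖R t‖ ≤ M)
    {x y : ℝ → E} (hx : ∀ t ∈ Icc a b, HasDerivWithinAt x (y t) (Icc a b) t)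
    (hy : ∀ t ∈ Icc a b, HasDerivWithinAt y (-(R t (x t))) (Icc a b) t) :
    (x a = 0 → y a = 0 → ∀ t ∈ Icc a b, x t = 0 ∧ y t = 0) ∧
    (x b = 0 → y b = 0 → ∀ t ∈ Icc a b, x t = 0 ∧ y t = 0) := by
  set v : ℝ → E × E → E × E := fun t p => (p.2, -(R t p.1)) with hv
  set K : NNReal := ⟨max 1 M, le_trans hM (le_max_right _ _)⟩ with hK
  have hlip : ∀ t ∈ Icc a b, LipschitzOnWith K (v t) univ := by
    intro t ht
    apply LipschitzWith.lipschitzOnWith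
    apply LipschitzWith.of_dist_le_mul
    intro p q
    change dist (v t p) (v t q) ≤ max 1 M * dist p q
    rw [Prod.dist_eq (x := v t p)]
    apply max_le
    · change dist p.2 q.2 ≤ _
      calc dist p.2 q.2 ≤ 1 * dist p q := by rw [one_mul]; exact le_max_right _ _
        _ ≤ _ := by gcongr; exact le_max_left _ _
    · change dist (-(R t p.1)) (-(R t q.1)) ≤ _
      rw [dist_neg_neg, dist_eq_norm, ← map_sub]
      calc _ ≤ ‖R t‖ * ‖p.1 - q.1‖ := (R t).le_opNorm _
        _ ≤ max 1 M * dist p q := by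
          gcongr
          · exact (hR t ht).trans (le_max_right _ _)
          · rw [← dist_eq_norm]; exact le_max_left _ _
  have hf : ∀ t ∈ Icc a b, HasDerivWithinAt (fun t => (x t, y t)) (v t (x t, y t)) (Icc a b) t :=
    fun t ht => (hx t ht).prodMk (hy t ht)
  have hfc : ContinuousOn (fun t => (x t, y t)) (Icc a b) := fun t ht => (hf t ht).continuousWithinAt
  have hg : ∀ t, ∀ s, HasDerivWithinAt (fun _ : ℝ => (0 : E × E)) (v t 0) s t := by
    intro t s
    have : v t 0 = 0 := by simp [hv]
    rw [this]
    exact hasDerivWithinAt_const _ _ _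
  constructor
  · intro h1 h2 t ht
    have := ODE_solution_unique_of_mem_Icc_right (v := v) (s := fun _ => univ) (K := K)
      (f := fun t => (x t, y t)) (g := fun _ => 0) (a := a) (b := b)
      (fun t ht => hlip t (Ico_subset_Icc_self ht)) hfc
      (fun t ht => (hf t (Ico_subset_Icc_self ht)).mono_of_mem_nhdsWithin
        (Icc_mem_nhdsGE_of_mem ht)) (fun _ _ => mem_univ _)
      continuousOn_const (fun t _ => hg t _) (fun _ _ => mem_univ _) (by simp [h1, h2]) ht
    simpa using this
  · intro h1 h2 t ht
    have := ODE_solution_unique_of_mem_Icc_left (v := v) (s := fun _ => univ) (K := K)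
      (f := fun t => (x t, y t)) (g := fun _ => 0) (a := a) (b := b)
      (fun t ht => hlip t (Ioc_subset_Icc_self ht)) hfc
      (fun t ht => (hf t (Ioc_subset_Icc_self ht)).mono_of_mem_nhdsWithin
        (Icc_mem_nhdsLE_of_mem ht)) (fun _ _ => mem_univ _)
      continuousOn_const (fun t _ => hg t _) (fun _ _ => mem_univ _) (by simp [h1, h2]) ht
    simpa using this

theorem second_order_exists {G : Type*} [NormedAddCommGroup G] [NormedSpace ℝ G] [CompleteSpace G]
    (r : ℝ → G →L[ℝ] G) (hr : Continuous r) (M : ℝ) (hM : ∀ t, ‖r t‖ ≤ M)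
    (x₀ y₀ : G) (T : ℝ) (hT : 0 ≤ T) :
    ∃ X Y : ℝ → G, X 0 = x₀ ∧ Y 0 = y₀ ∧
      ∀ t ∈ Icc (0:ℝ) T, HasDerivAt X (Y t) t ∧ HasDerivAt Y (-(r t (X t))) t := by
  let A : ℝ → (G × G) →L[ℝ] (G × G) := fun t =>
    (ContinuousLinearMap.inl ℝ G G) ∘L (ContinuousLinearMap.snd ℝ G G)
      - (ContinuousLinearMap.inr ℝ G G) ∘L ((r t) ∘L ContinuousLinearMap.fst ℝ G G)
  have hA : Continuous A := by
    apply continuous_const.sub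
    apply continuous_const.clm_comp
    exact hr.clm_comp continuous_const
  have hb : ∀ t, ‖A t‖ ≤ max 1 M := by
    intro t
    apply ContinuousLinearMap.opNorm_le_bound _ (by positivity)
    intro p
    have : A t p = (p.2, -(r t p.1)) := by simp [A]
    rw [this, Prod.norm_def]
    apply max_le
    · calc ‖p.2‖ ≤ 1 * ‖p‖ := by rw [one_mul]; exact le_max_right _ _
        _ ≤ _ := by gcongr; exact le_max_left _ _
    · simp only [norm_neg]
      calc _ ≤ ‖r t‖ * ‖p.1‖ := (r t).le_opNorm _
        _ ≤ max 1 M * ‖p‖ := by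
          gcongr
          · exact (hM t).trans (le_max_right _ _)
          · exact le_max_left _ _
  obtain ⟨X, hX0, hX⟩ := lin_ode_exists A hA (max 1 M) (by positivity) hb (x₀, y₀) T hT
  refine ⟨fun t => (X t).1, fun t => (X t).2, by simp [hX0], by simp [hX0], ?_⟩
  intro t ht
  constructor
  · simpa [A, Function.comp_def] using
      (ContinuousLinearMap.fst ℝ G G).hasFDerivAt.comp_hasDerivAt t (hX t ht)
  · simpa [A, Function.comp_def] using
      (ContinuousLinearMap.snd ℝ G G).hasFDerivAt.comp_hasDerivAt t (hX t ht)

/-- Fundamental solution of the Jacobi equation with the Lagrangian boundary condition. -/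
structure JacobiPair (τ : ℝ) (R : ℝ → E →L[ℝ] E) (E₀ : Submodule ℝ E) (Q : E →ₗ[ℝ] E →ₗ[ℝ] ℝ)
    (U W : ℝ → E →L[ℝ] E) : Prop where
  hU : ∀ t ∈ Icc 0 τ, HasDerivAt U (W t) t
  hW : ∀ t ∈ Icc 0 τ, HasDerivAt W (-(R t ∘L U t)) t
  lag : ∀ t ∈ Icc 0 τ, ∀ e f, ⟪U t e, W t f⟫ = ⟪W t e, U t f⟫
  inj : ∀ t ∈ Icc 0 τ, ∀ e, U t e = 0 → W t e = 0 → e = 0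
  mem : ∀ e, U 0 e ∈ E₀
  bdry : ∀ e, ∀ w ∈ E₀, ⟪W 0 e, w⟫ = -(Q (U 0 e) w)
  surj : ∀ x ∈ E₀, ∀ y, (∀ w ∈ E₀, ⟪y, w⟫ = -(Q x w)) → ∃ e, U 0 e = x ∧ W 0 e = y
  range : ∀ x ∈ E₀, ∃ e, U 0 e = x

theorem JacobiPair.hUe {τ : ℝ} {R : ℝ → E →L[ℝ] E} {E₀ : Submodule ℝ E}
    {Q : E →ₗ[ℝ] E →ₗ[ℝ] ℝ} {U W : ℝ → E →L[ℝ] E} (J : JacobiPair τ R E₀ Q U W)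
    {t : ℝ} (ht : t ∈ Icc 0 τ) (e : E) : HasDerivAt (fun t => U t e) (W t e) t := by
  simpa using (J.hU t ht).clm_apply (hasDerivAt_const t e)

theorem JacobiPair.hWe {τ : ℝ} {R : ℝ → E →L[ℝ] E} {E₀ : Submodule ℝ E}
    {Q : E →ₗ[ℝ] E →ₗ[ℝ] ℝ} {U W : ℝ → E →L[ℝ] E} (J : JacobiPair τ R E₀ Q U W)
    {t : ℝ} (ht : t ∈ Icc 0 τ) (e : E) : HasDerivAt (fun t => W t e) (-(R t (U t e))) t := by
  simpa using (J.hW t ht).clm_apply (hasDerivAt_const t e)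

theorem exists_jacobiPair [FiniteDimensional ℝ E] (τ : ℝ) (hτ : 0 < τ)
    (R : ℝ → E →L[ℝ] E) (hRcont : ContinuousOn R (Set.Icc 0 τ))
    (hRsa : ∀ t ∈ Set.Icc (0:ℝ) τ, ∀ u v : E, ⟪R t u, v⟫ = ⟪u, R t v⟫)
    (E₀ : Submodule ℝ E) (Q : E →ₗ[ℝ] E →ₗ[ℝ] ℝ)
    (hQsymm : ∀ x ∈ E₀, ∀ y ∈ E₀, Q x y = Q y x) :
    ∃ U W, JacobiPair τ R E₀ Q U W := by
  have : CompleteSpace E := FiniteDimensional.complete ℝ E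
  obtain ⟨S, hS⟩ : ∃ S : E →L[ℝ] E, ∀ x w, ⟪S x, w⟫ = Q x w := by
    refine ⟨LinearMap.toContinuousLinearMap
      { toFun := fun x => (InnerProductSpace.toDual ℝ E).symm (LinearMap.toContinuousLinearMap (Q x))
        map_add' := fun x y => by simp
        map_smul' := fun c x => by simp }, ?_⟩
    intro x w
    simp
  set P : E →L[ℝ] E := E₀.starProjection with hP
  set U0 : E →L[ℝ] E := P
  set W0 : E →L[ℝ] E := (ContinuousLinearMap.id ℝ E - P) - S ∘L P
  have hPmem : ∀ e, P e ∈ E₀ := fun e => Submodule.starProjection_apply_mem _ _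
  have hPperp : ∀ e, ∀ w ∈ E₀, ⟪e - P e, w⟫ = 0 := fun e w hw =>
    Submodule.starProjection_inner_eq_zero e w hw
  set Rt : ℝ → E →L[ℝ] E := IccExtend hτ.le ((Icc 0 τ).domRestrict R) with hRt
  have hRtc : Continuous Rt := (continuousOn_iff_continuous_domRestrict.1 hRcont).Icc_extend'
  have hext : ∀ s ∈ Icc 0 τ, Rt s = R s := fun s hs => by
    rw [hRt, IccExtend_of_mem _ _ hs]; rfl
  obtain ⟨MR, hMR⟩ := (isCompact_Icc (a := 0) (b := τ)).exists_bound_of_continuousOn hRcont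
  have hMR0 : 0 ≤ MR := (norm_nonneg _).trans (hMR 0 ⟨le_rfl, hτ.le⟩)
  obtain ⟨U, W, hUz, hWz, hX⟩ := second_order_exists
    (fun t => ContinuousLinearMap.compL ℝ E E E (Rt t))
    ((ContinuousLinearMap.compL ℝ E E E).continuous.comp hRtc)
    MR (fun t => by
      refine ContinuousLinearMap.opNorm_le_bound _ hMR0 fun T => ?_
      refine (ContinuousLinearMap.opNorm_comp_le (Rt t) T).trans ?_
      gcongr
      exact hMR _ (projIcc 0 τ hτ.le t).2) U0 W0 τ hτ.le
  have hU : ∀ t ∈ Icc 0 τ, HasDerivAt U (W t) t := fun t ht => (hX t ht).1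
  have hW : ∀ t ∈ Icc 0 τ, HasDerivAt W (-(R t ∘L U t)) t := fun t ht => by
    have := (hX t ht).2
    rw [hext t ht] at this
    exact this
  have hUe : ∀ t ∈ Icc 0 τ, ∀ e, HasDerivAt (fun t => U t e) (W t e) t := fun t ht e => by
    simpa using (hU t ht).clm_apply (hasDerivAt_const t e)
  have hWe : ∀ t ∈ Icc 0 τ, ∀ e, HasDerivAt (fun t => W t e) (-(R t (U t e))) t :=
    fun t ht e => by
      simpa using (hW t ht).clm_apply (hasDerivAt_const t e)
  have hU0 : ∀ e, U 0 e = P e := fun e => by rw [hUz]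
  have hW0 : ∀ e, W 0 e = e - P e - S (P e) := fun e => by rw [hWz]; simp [W0]
  refine ⟨U, W, ⟨hU, hW, ?_, ?_, ?_, ?_, ?_, ?_⟩⟩
  · intro t ht e f
    have hd : ∀ s ∈ Icc 0 τ, HasDerivAt
        (fun s => ⟪U s e, W s f⟫ - ⟪W s e, U s f⟫) 0 s := by
      intro s hs
      have h1 := ((hUe s hs e).inner ℝ (hWe s hs f)).sub ((hWe s hs e).inner ℝ (hUe s hs f))
      refine h1.congr_deriv ?_
      rw [inner_neg_right, inner_neg_left, hRsa s hs]
      ring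
    have h2 := constant_of_derivWithin_zero (a := 0) (b := τ)
      (f := fun s => ⟪U s e, W s f⟫ - ⟪W s e, U s f⟫)
      (fun s hs => (hd s hs).differentiableAt.differentiableWithinAt)
      (fun s hs => (hd s (Ico_subset_Icc_self hs)).hasDerivWithinAt.derivWithin
        (uniqueDiffOn_Icc hτ s (Ico_subset_Icc_self hs))) t ht
    have h3 : ⟪U 0 e, W 0 f⟫ - ⟪W 0 e, U 0 f⟫ = 0 := by
      rw [hU0, hU0, hW0, hW0, inner_sub_left (e - P e), hPperp e _ (hPmem f), inner_sub_right,
        real_inner_comm (f - P f), hPperp f _ (hPmem e), real_inner_comm (S (P f)), hS, hS,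
        hQsymm _ (hPmem f) _ (hPmem e)]
      ring
    beta_reduce at h2
    rw [h3] at h2
    linarith
  · intro t ht e h1 h2
    have := (ode_zero (R := R) (a := 0) (b := t) hMR0 (fun s hs => hMR s ⟨hs.1, hs.2.trans ht.2⟩)
      (x := fun t => U t e) (y := fun t => W t e)
      (fun s hs => (hUe s ⟨hs.1, hs.2.trans ht.2⟩ e).hasDerivWithinAt)
      (fun s hs => (hWe s ⟨hs.1, hs.2.trans ht.2⟩ e).hasDerivWithinAt)).2 h1 h2 0 ⟨le_rfl, ht.1⟩
    rw [hU0, hW0] at this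
    obtain ⟨h3, h4⟩ := this
    rw [h3] at h4
    simpa using h4
  · intro e
    rw [hU0]; exact hPmem e
  · intro e w hw
    rw [hU0, hW0, inner_sub_left, hPperp e w hw, hS]; simp
  · intro x hx y hy
    have h5 : P (y + S x) = 0 := by
      change E₀.starProjection _ = 0
      rw [Submodule.starProjection_apply_eq_zero_iff]
      intro w hw
      rw [real_inner_comm, inner_add_left, hy w hw, hS]; ring
    have h6 : P x = x := Submodule.starProjection_eq_self_iff.2 hx
    refine ⟨x + (y + S x), ?_, ?_⟩
    · rw [hU0, map_add, h5, h6, add_zero]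
    · rw [hW0, map_add, h5, h6, add_zero]; abel
  · intro x hx
    exact ⟨x, by rw [hU0]; exact Submodule.starProjection_eq_self_iff.2 hx⟩

end PartB

end FileB

section FileC

open Set Filter Topology MeasureTheory

open scoped RealInnerProductSpace

section PartC

variable {E : Type*} [NormedAddCommGroup E] [InnerProductSpace ℝ E]

theorem contDiffOn_two_of {f g h : ℝ → E} {a b : ℝ} (hab : a < b)
    (hf : ∀ t ∈ Icc a b, HasDerivAt f (g t) t) (hg : ∀ t ∈ Icc a b, HasDerivAt g (h t) t)
    (hh : ContinuousOn h (Icc a b)) : ContDiffOn ℝ 2 f (Icc a b) := by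
  have hu := uniqueDiffOn_Icc hab
  have h1 : ∀ t ∈ Icc a b, derivWithin f (Icc a b) t = g t := fun t ht =>
    (hf t ht).hasDerivWithinAt.derivWithin (hu t ht)
  have h2 : ∀ t ∈ Icc a b, derivWithin g (Icc a b) t = h t := fun t ht =>
    (hg t ht).hasDerivWithinAt.derivWithin (hu t ht)
  rw [show (2 : WithTop ℕ∞) = 1 + 1 by norm_num, contDiffOn_succ_iff_derivWithin hu]
  refine ⟨fun t ht => (hf t ht).differentiableAt.differentiableWithinAt, by simp, ?_⟩
  refine ContDiffOn.congr ?_ h1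
  rw [contDiffOn_one_iff_derivWithin hu]
  exact ⟨fun t ht => (hg t ht).differentiableAt.differentiableWithinAt, hh.congr h2⟩

variable {τ : ℝ} {R : ℝ → E →L[ℝ] E} {E₀ : Submodule ℝ E}
    {Q : E →ₗ[ℝ] E →ₗ[ℝ] ℝ} {U W : ℝ → E →L[ℝ] E}

theorem JacobiPair.contU (J : JacobiPair τ R E₀ Q U W) : ContinuousOn U (Icc 0 τ) :=
  fun t ht => (J.hU t ht).continuousAt.continuousWithinAt

theorem JacobiPair.contW (J : JacobiPair τ R E₀ Q U W) : ContinuousOn W (Icc 0 τ) :=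
  fun t ht => (J.hW t ht).continuousAt.continuousWithinAt

theorem JacobiPair.focal_of (J : JacobiPair τ R E₀ Q U W) (hRcont : ContinuousOn R (Icc 0 τ))
    {a : ℝ} (ha : a ∈ Ioc 0 τ) {e : E} (he : U a e = 0) :
    IsFocalSolution R E₀ Q a (fun t => U t e) := by
  have hsub : Icc 0 a ⊆ Icc 0 τ := Icc_subset_Icc_right ha.2
  have hu := uniqueDiffOn_Icc ha.1
  have h1 : ∀ t ∈ Icc 0 a, derivWithin (fun t => U t e) (Icc 0 a) t = W t e := fun t ht =>
    (J.hUe (hsub ht) e).hasDerivWithinAt.derivWithin (hu t ht)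
  refine ⟨?_, ?_, J.mem e, ?_, he⟩
  · exact contDiffOn_two_of ha.1 (fun t ht => J.hUe (hsub ht) e) (fun t ht => J.hWe (hsub ht) e)
      ((hRcont.clm_apply (J.contU.clm_apply continuousOn_const)).neg.mono hsub)
  · intro t ht
    rw [derivWithin_congr h1 (h1 t ht),
      (J.hWe (hsub ht) e).hasDerivWithinAt.derivWithin (hu t ht)]
    simp
  · intro w hw
    rw [h1 0 ⟨le_rfl, ha.1.le⟩]
    exact J.bdry e w hw

theorem JacobiPair.focal_exists (J : JacobiPair τ R E₀ Q U W) (hRcont : ContinuousOn R (Icc 0 τ))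
    {a : ℝ} (ha : a ∈ Ioc 0 τ) {u : ℝ → E} (hu : IsFocalSolution R E₀ Q a u) :
    ∃ e, U a e = 0 ∧ ∀ t ∈ Icc 0 a, u t = U t e := by
  obtain ⟨hC, hode, hu0, hbd, hua⟩ := hu
  have hsub : Icc 0 a ⊆ Icc 0 τ := Icc_subset_Icc_right ha.2
  have hud := uniqueDiffOn_Icc ha.1
  obtain ⟨e, he1, he2⟩ := J.surj (u 0) hu0 _ hbd
  obtain ⟨M, hM⟩ := (isCompact_Icc (a := 0) (b := τ)).exists_bound_of_continuousOn hRcont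
  have hM0 : 0 ≤ M := (norm_nonneg _).trans (hM 0 ⟨le_rfl, ha.1.le.trans ha.2⟩)
  rw [show (2 : WithTop ℕ∞) = 1 + 1 by norm_num, contDiffOn_succ_iff_derivWithin hud] at hC
  obtain ⟨hd1, -, hC1⟩ := hC
  have hd2 := hC1.differentiableOn (by norm_num)
  have key := (ode_zero (R := R) (a := 0) (b := a) hM0 (fun s hs => hM s (hsub hs))
    (x := fun t => u t - U t e) (y := fun t => derivWithin u (Icc 0 a) t - W t e)
    (fun t ht => (hd1 t ht).hasDerivWithinAt.sub (J.hUe (hsub ht) e).hasDerivWithinAt)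
    (fun t ht => by
      refine ((hd2 t ht).hasDerivWithinAt.sub
        (J.hWe (hsub ht) e).hasDerivWithinAt).congr_deriv ?_
      rw [eq_neg_of_add_eq_zero_left (hode t ht), map_sub]
      abel)).1 (by simp [he1]) (by simp [he2])
  have key' : ∀ t ∈ Icc 0 a, u t = U t e := fun t ht => sub_eq_zero.1 (key t ht).1
  exact ⟨e, by rw [← key' a ⟨ha.1.le, le_rfl⟩, hua], key'⟩

theorem JacobiPair.eq_zero (J : JacobiPair τ R E₀ Q U W)
    {a : ℝ} (ha : a ∈ Ioc 0 τ) {e : E} (he : ∀ t ∈ Icc 0 a, U t e = 0) : e = 0 := by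
  have hud := uniqueDiffOn_Icc ha.1
  have h0 : (0:ℝ) ∈ Icc 0 a := ⟨le_rfl, ha.1.le⟩
  have h0' : (0:ℝ) ∈ Icc 0 τ := ⟨le_rfl, ha.1.le.trans ha.2⟩
  apply J.inj 0 h0' e (he 0 h0)
  have h1 := (J.hUe h0' e).hasDerivWithinAt.derivWithin (hud 0 h0)
  rw [← h1, derivWithin_congr (f := fun _ => (0:E)) he (he 0 h0)]
  simp

theorem JacobiPair.isFocalPoint_iff (J : JacobiPair τ R E₀ Q U W)
    (hRcont : ContinuousOn R (Icc 0 τ)) {a : ℝ} :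
    IsFocalPoint R E₀ Q τ a ↔ a ∈ Ioc 0 τ ∧ ∃ e, e ≠ 0 ∧ U a e = 0 := by
  constructor
  · rintro ⟨ha, u, hu, t, ht, hne⟩
    obtain ⟨e, he, heq⟩ := J.focal_exists hRcont ha hu
    refine ⟨ha, e, ?_, he⟩
    rintro rfl
    apply hne
    rw [heq t ht, map_zero]
  · rintro ⟨ha, e, hne, he⟩
    refine ⟨ha, _, J.focal_of hRcont ha he, ?_⟩
    by_contra! h
    exact hne (J.eq_zero ha h)

theorem JacobiPair.focalMultiplicity_eq [FiniteDimensional ℝ E] (J : JacobiPair τ R E₀ Q U W)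
    (hRcont : ContinuousOn R (Icc 0 τ)) {a : ℝ} (ha : a ∈ Ioc 0 τ) :
    focalMultiplicity R E₀ Q a = Module.finrank ℝ (LinearMap.ker (U a : E →ₗ[ℝ] E)) := by
  unfold focalMultiplicity
  apply IsGreatest.csSup_eq
  constructor
  · let b := Module.finBasis ℝ (LinearMap.ker (U a : E →ₗ[ℝ] E))
    refine ⟨fun i t => U t (b i), fun i => J.focal_of hRcont ha (b i).2, ?_⟩
    intro c hc
    have h1 : ∑ i, c i • (b i : E) = 0 := by
      apply J.eq_zero ha
      intro t ht
      simpa using hc t ht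
    have h2 : ∑ i, c i • b i = 0 := by
      apply Subtype.ext
      simpa using h1
    funext i
    exact Fintype.linearIndependent_iff.1 b.linearIndependent c h2 i
  · rintro n ⟨u, hu, hind⟩
    choose e he heq using fun i => J.focal_exists hRcont ha (hu i)
    have hli : LinearIndependent ℝ (fun i => (⟨e i, he i⟩ : LinearMap.ker (U a : E →ₗ[ℝ] E))) := by
      rw [Fintype.linearIndependent_iff]
      intro c hc i
      have h1 : ∑ i, c i • e i = 0 := by
        have := congrArg Subtype.val hc
        simpa using this
      have := hind c (fun t ht => by
        have h2 : ∑ i, c i • u i t = U t (∑ i, c i • e i) := by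
          rw [map_sum]
          exact Finset.sum_congr rfl fun i _ => by rw [heq i t ht, map_smul]
        rw [h2, h1, map_zero])
      rw [this]; rfl
    simpa using hli.fintype_card_le_finrank

theorem JacobiPair.finite_singular [FiniteDimensional ℝ E] (J : JacobiPair τ R E₀ Q U W) :
    {t : ℝ | t ∈ Icc 0 τ ∧ ∃ e, e ≠ 0 ∧ U t e = 0}.Finite := by
  by_contra hinf
  obtain ⟨a, ha, hacc⟩ := Set.Infinite.exists_accPt_of_subset_isCompact hinf
    (isCompact_Icc (a := (0:ℝ)) (b := τ)) (fun t ht => ht.1)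
  rw [accPt_iff_frequently_nhdsNE] at hacc
  obtain ⟨t, htlim, ht⟩ := exists_seq_forall_of_frequently hacc
  choose htI e hene hUe using ht
  let z : ℕ → E := fun n => ‖e n‖⁻¹ • e n
  have hz : ∀ n, z n ∈ Metric.sphere (0:E) 1 := fun n => by
    simp [z, norm_smul, inv_mul_cancel₀ (norm_ne_zero_iff.2 (hene n))]
  have hUz : ∀ n, U (t n) (z n) = 0 := fun n => by simp [z, hUe]
  obtain ⟨z₀, hz₀, φ, hφ, hlim⟩ := (isCompact_sphere (0:E) 1).tendsto_subseq hz
  have hz₀ne : z₀ ≠ 0 := by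
    rintro rfl
    simp at hz₀
  have htφ : Tendsto (t ∘ φ) atTop (𝓝[≠] a) := htlim.comp hφ.tendsto_atTop
  have htφ' : Tendsto (t ∘ φ) atTop (𝓝 a) := htφ.mono_right nhdsWithin_le_nhds
  have hUlim : Tendsto (fun n => U (t (φ n)) (z (φ n))) atTop (𝓝 (U a z₀)) :=
    ((isBoundedBilinearMap_apply (𝕜 := ℝ) (E := E) (F := E)).continuous.tendsto (U a, z₀)).comp
      (((J.hU a ha).continuousAt.tendsto.comp htφ').prodMk_nhds hlim)
  have hWlim : Tendsto (fun n => W (t (φ n)) (z (φ n))) atTop (𝓝 (W a z₀)) :=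
    ((isBoundedBilinearMap_apply (𝕜 := ℝ) (E := E) (F := E)).continuous.tendsto (W a, z₀)).comp
      (((J.hW a ha).continuousAt.tendsto.comp htφ').prodMk_nhds hlim)
  have hU0 : U a z₀ = 0 := by
    refine tendsto_nhds_unique hUlim ?_
    simp only [hUz]
    exact tendsto_const_nhds
  have hslope : Tendsto (fun n => slope (fun t => U t z₀) a (t (φ n))) atTop (𝓝 (W a z₀)) :=
    (hasDerivAt_iff_tendsto_slope.1 (J.hUe ha z₀)).comp htφ
  have hin := hWlim.inner hslope (𝕜 := ℝ)
  have hzero : ∀ n, ⟪W (t (φ n)) (z (φ n)), slope (fun t => U t z₀) a (t (φ n))⟫ = 0 := by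
    intro n
    rw [slope_def_module, hU0, sub_zero, inner_smul_right, ← J.lag _ (htI (φ n)), hUz]
    simp
  simp only [hzero] at hin
  have h0 := tendsto_nhds_unique hin tendsto_const_nhds
  exact hz₀ne (J.inj a ha z₀ hU0 (inner_self_eq_zero.1 h0))

end PartC

end FileC

section FileD

open Set Filter Topology MeasureTheory

open scoped RealInnerProductSpace

section PartD

/-- Essentially bounded measurable functions on an open interval. -/
def BM {F : Type*} [NormedAddCommGroup F] (α β : ℝ) (f : ℝ → F) : Prop :=
  AEStronglyMeasurable f (volume.restrict (Ioo α β)) ∧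
    ∃ C : ℝ, ∀ᵐ t ∂(volume.restrict (Ioo α β)), ‖f t‖ ≤ C

theorem BM.mono {F : Type*} [NormedAddCommGroup F] {α β α' β' : ℝ} {f : ℝ → F}
    (h : BM α β f) (h1 : α ≤ α') (h2 : β' ≤ β) : BM α' β' f := by
  obtain ⟨h3, C, hC⟩ := h
  have : volume.restrict (Ioo α' β') ≤ volume.restrict (Ioo α β) :=
    Measure.restrict_mono (Ioo_subset_Ioo h1 h2) le_rfl
  exact ⟨h3.mono_measure this, C, ae_mono this hC⟩

theorem BM.intervalIntegrable {F : Type*} [NormedAddCommGroup F] {α β : ℝ} {f : ℝ → F}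
    (h : BM α β f) (hab : α ≤ β) : IntervalIntegrable f volume α β := by
  obtain ⟨h3, C, hC⟩ := h
  rw [intervalIntegrable_iff_integrableOn_Ioo_of_le hab]
  exact IntegrableOn.of_bound (by simp) h3 C hC

theorem BM.of_cont {F : Type*} [NormedAddCommGroup F] {α β : ℝ} {f : ℝ → F}
    (h : ContinuousOn f (Icc α β)) : BM α β f := by
  obtain ⟨C, hC⟩ := isCompact_Icc.exists_bound_of_continuousOn h
  refine ⟨(h.mono Ioo_subset_Icc_self).aestronglyMeasurable measurableSet_Ioo, C, ?_⟩
  rw [ae_restrict_iff' measurableSet_Ioo]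
  exact ae_of_all _ fun t ht => hC t (Ioo_subset_Icc_self ht)

theorem BM.add {F : Type*} [NormedAddCommGroup F] {α β : ℝ} {f g : ℝ → F}
    (h : BM α β f) (h' : BM α β g) : BM α β (fun t => f t + g t) := by
  obtain ⟨h3, C, hC⟩ := h
  obtain ⟨h3', C', hC'⟩ := h'
  refine ⟨h3.add h3', C + C', ?_⟩
  filter_upwards [hC, hC'] with t h1 h2
  exact (norm_add_le _ _).trans (by gcongr)

theorem BM.neg {F : Type*} [NormedAddCommGroup F] {α β : ℝ} {f : ℝ → F}
    (h : BM α β f) : BM α β (fun t => - f t) := by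
  obtain ⟨h3, C, hC⟩ := h
  refine ⟨h3.neg, C, ?_⟩
  simpa using hC

theorem BM.sub {F : Type*} [NormedAddCommGroup F] {α β : ℝ} {f g : ℝ → F}
    (h : BM α β f) (h' : BM α β g) : BM α β (fun t => f t - g t) := by
  simpa [sub_eq_add_neg] using h.add h'.neg

variable {E : Type*} [NormedAddCommGroup E] [InnerProductSpace ℝ E]

theorem BM.inner {α β : ℝ} {f g : ℝ → E}
    (h : BM α β f) (h' : BM α β g) : BM α β (fun t => ⟪f t, g t⟫) := by
  obtain ⟨h3, C, hC⟩ := h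
  obtain ⟨h3', C', hC'⟩ := h'
  refine ⟨h3.inner h3', C * C', ?_⟩
  filter_upwards [hC, hC'] with t h1 h2
  exact (norm_inner_le_norm _ _).trans
    (mul_le_mul h1 h2 (norm_nonneg _) ((norm_nonneg _).trans h1))

/-- Continuous, with derivative off a finite set, boundedly. -/
structure Adm (α β : ℝ) (v v' : ℝ → E) : Prop where
  cont : ContinuousOn v (Icc α β)
  der : ∃ (P : Set ℝ) (C : ℝ), P.Finite ∧ 0 ≤ C ∧
    ∀ t ∈ Ioo α β \ P, HasDerivAt v (v' t) t ∧ ‖v' t‖ ≤ C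

theorem Adm.mono {α β α' β' : ℝ} {v v' : ℝ → E} (h : Adm α β v v') (h1 : α ≤ α') (h2 : β' ≤ β) :
    Adm α' β' v v' := by
  obtain ⟨hc, P, C, hP, hC, hd⟩ := h
  exact ⟨hc.mono (Icc_subset_Icc h1 h2), P, C, hP, hC,
    fun t ht => hd t ⟨Ioo_subset_Ioo h1 h2 ht.1, ht.2⟩⟩

theorem ae_notMem_finite {P : Set ℝ} (hP : P.Finite) {s : Set ℝ} :
    ∀ᵐ t ∂(volume.restrict s), t ∉ P := by
  apply ae_restrict_of_ae
  exact measure_eq_zero_iff_ae_notMem.1 (hP.measure_zero volume)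

theorem Adm.bm [FiniteDimensional ℝ E] {α β : ℝ} {v v' : ℝ → E} (h : Adm α β v v') :
    BM α β v' := by
  have : CompleteSpace E := FiniteDimensional.complete ℝ E
  obtain ⟨hc, P, C, hP, hC, hd⟩ := h
  have hae : ∀ᵐ t ∂(volume.restrict (Ioo α β)), HasDerivAt v (v' t) t ∧ ‖v' t‖ ≤ C := by
    filter_upwards [ae_notMem_finite hP, ae_restrict_mem measurableSet_Ioo] with t h1 h2
    exact hd t ⟨h2, h1⟩
  refine ⟨?_, C, hae.mono fun t ht => ht.2⟩
  have hm : AEStronglyMeasurable (deriv v) (volume.restrict (Ioo α β)) :=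
    aestronglyMeasurable_deriv v _
  exact hm.congr (hae.mono fun t ht => ht.1.deriv)

theorem Adm.of_hasDerivAt {α β : ℝ} {v v' : ℝ → E} (h : ∀ t ∈ Icc α β, HasDerivAt v (v' t) t)
    (hc : ContinuousOn v' (Icc α β)) : Adm α β v v' := by
  obtain ⟨C, hC⟩ := isCompact_Icc.exists_bound_of_continuousOn hc
  refine ⟨fun t ht => (h t ht).continuousAt.continuousWithinAt, ∅, |C|, finite_empty, by simp, ?_⟩
  intro t ht
  have ht := Ioo_subset_Icc_self ht.1
  exact ⟨h t ht, (hC t ht).trans (le_abs_self C)⟩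

theorem Adm.zero {α β : ℝ} : Adm α β (fun _ => (0:E)) (fun _ => 0) :=
  Adm.of_hasDerivAt (fun t _ => hasDerivAt_const t _) continuousOn_const

theorem Adm.add {α β : ℝ} {v v' u u' : ℝ → E} (h : Adm α β v v') (k : Adm α β u u') :
    Adm α β (fun t => v t + u t) (fun t => v' t + u' t) := by
  obtain ⟨hc, P, C, hP, hC, hd⟩ := h
  obtain ⟨hc', P', C', hP', hC', hd'⟩ := k
  refine ⟨hc.add hc', P ∪ P', C + C', hP.union hP', by positivity, ?_⟩
  intro t ht
  obtain ⟨h1, h2⟩ := hd t ⟨ht.1, fun h => ht.2 (Or.inl h)⟩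
  obtain ⟨h3, h4⟩ := hd' t ⟨ht.1, fun h => ht.2 (Or.inr h)⟩
  exact ⟨h1.add h3, (norm_add_le _ _).trans (by gcongr)⟩

theorem Adm.smul {α β : ℝ} {v v' : ℝ → E} (h : Adm α β v v') (c : ℝ) :
    Adm α β (fun t => c • v t) (fun t => c • v' t) := by
  obtain ⟨hc, P, C, hP, hC, hd⟩ := h
  refine ⟨hc.const_smul c, P, |c| * C, hP, by positivity, ?_⟩
  intro t ht
  obtain ⟨h1, h2⟩ := hd t ht
  refine ⟨h1.const_smul c, ?_⟩
  rw [norm_smul, Real.norm_eq_abs]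
  gcongr

theorem Adm.sub {α β : ℝ} {v v' u u' : ℝ → E} (h : Adm α β v v') (k : Adm α β u u') :
    Adm α β (fun t => v t - u t) (fun t => v' t - u' t) := by
  simpa [sub_eq_add_neg] using h.add (k.smul (-1))

theorem Adm.sum {ι : Type*} {α β : ℝ} {v v' : ι → ℝ → E} (s : Finset ι)
    (h : ∀ i ∈ s, Adm α β (v i) (v' i)) :
    Adm α β (fun t => ∑ i ∈ s, v i t) (fun t => ∑ i ∈ s, v' i t) := by
  classical
  induction s using Finset.induction_on with
  | empty => simpa using Adm.zero
  | insert a s ha ih =>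
    simp only [Finset.sum_insert ha]
    exact (h a (Finset.mem_insert_self _ _)).add
      (ih fun i hi => h i (Finset.mem_insert_of_mem hi))

theorem Adm.lipschitz [FiniteDimensional ℝ E] {α β : ℝ} {v v' : ℝ → E} (h : Adm α β v v') :
    ∃ C, 0 ≤ C ∧ ∀ s t, α ≤ s → s ≤ t → t ≤ β → ‖v t - v s‖ ≤ C * (t - s) := by
  have : CompleteSpace E := FiniteDimensional.complete ℝ E
  obtain ⟨P, C, hP, hC, hd⟩ := h.der
  refine ⟨C, hC, fun s t h1 h2 h3 => ?_⟩
  have hk := h.mono h1 h3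
  have := integral_eq_of_hasDerivAt_off_countable_of_le v v' h2 hP.countable hk.cont
    (fun x hx => (hd x ⟨Ioo_subset_Ioo h1 h3 hx.1, hx.2⟩).1) (hk.bm.intervalIntegrable h2)
  rw [← this]
  have h4 := intervalIntegral.norm_integral_le_of_norm_le_const_ae (a := s) (b := t) (C := C)
    (f := v') (by
      filter_upwards [measure_eq_zero_iff_ae_notMem.1 (hP.measure_zero volume),
        measure_eq_zero_iff_ae_notMem.1 ((finite_singleton t).measure_zero volume)] with x hx hxt hx'
      rw [uIoc_of_le h2] at hx'
      exact (hd x ⟨⟨h1.trans_lt hx'.1, (lt_of_le_of_ne hx'.2 hxt).trans_le h3⟩, hx⟩).2)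
  rwa [abs_of_nonneg (by linarith)] at h4

/-- integrand of the index form -/
def qf (R : ℝ → E →L[ℝ] E) (v v' : ℝ → E) (t : ℝ) : ℝ := ⟪v' t, v' t⟫ - ⟪R t (v t), v t⟫

/-- polarised integrand -/
def qb (R : ℝ → E →L[ℝ] E) (v v' u u' : ℝ → E) (t : ℝ) : ℝ := ⟪v' t, u' t⟫ - ⟪R t (v t), u t⟫

theorem qb_bm [FiniteDimensional ℝ E] {α β : ℝ} {R : ℝ → E →L[ℝ] E}
    (hR : ContinuousOn R (Icc α β)) {v v' u u' : ℝ → E}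
    (hv : Adm α β v v') (hu : Adm α β u u') : BM α β (qb R v v' u u') :=
  (hv.bm.inner hu.bm).sub ((BM.of_cont (hR.clm_apply hv.cont)).inner (BM.of_cont hu.cont))

theorem qf_bm [FiniteDimensional ℝ E] {α β : ℝ} {R : ℝ → E →L[ℝ] E}
    (hR : ContinuousOn R (Icc α β)) {v v' : ℝ → E}
    (hv : Adm α β v v') : BM α β (qf R v v') := qb_bm hR hv hv

theorem indexForm_eq {τ : ℝ} (hτ : 0 < τ) {R : ℝ → E →L[ℝ] E} {Q : E →ₗ[ℝ] E →ₗ[ℝ] ℝ}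
    {v v' : ℝ → E} (hv : Adm 0 τ v v') :
    indexForm R Q τ v = -(Q (v 0) (v 0)) + ∫ t in (0:ℝ)..τ, qf R v v' t := by
  unfold indexForm
  congr 1
  rw [intervalIntegral.integral_of_le hτ.le, intervalIntegral.integral_of_le hτ.le,
    integral_Ioc_eq_integral_Ioo, integral_Ioc_eq_integral_Ioo]
  apply integral_congr_ae
  obtain ⟨P, C, hP, hC, hd⟩ := hv.der
  filter_upwards [ae_notMem_finite hP, ae_restrict_mem measurableSet_Ioo] with t h1 h2
  have h3 := (hd t ⟨h2, h1⟩).1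
  have : derivWithin v (Icc 0 τ) t = v' t :=
    h3.hasDerivWithinAt.derivWithin (uniqueDiffOn_Icc hτ t (Ioo_subset_Icc_self h2))
  rw [this, qf]

theorem exists_piece {k : ℕ} (s : Fin (k + 1) → ℝ) {t : ℝ} (h0 : s 0 < t) (h1 : t < s (Fin.last k))
    : ∃ i : Fin k, s i.castSucc ≤ t ∧ t ≤ s i.succ := by
  induction k with
  | zero => exact absurd (h0.trans h1) (lt_irrefl _)
  | succ k ih =>
    rcases le_or_gt (s (Fin.last k).castSucc) t with h | h
    · exact ⟨Fin.last k, h, by simpa using h1.le⟩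
    · obtain ⟨i, hi1, hi2⟩ := ih (fun j => s j.castSucc) (by simpa using h0) h
      exact ⟨i.castSucc, hi1, by simpa using hi2⟩

theorem InOmega.adm {E₀ : Submodule ℝ E} {Q : E →ₗ[ℝ] E →ₗ[ℝ] ℝ} {τ : ℝ}
    {v : ℝ → E} (h : InOmega E₀ Q τ v) : Adm 0 τ v (deriv v) := by
  obtain ⟨⟨hc, k, s, hs, h0, h1, hC⟩, -⟩ := h
  have hb : ∀ i : Fin k, ∃ C, ∀ t ∈ Icc (s i.castSucc) (s i.succ),
      ‖derivWithin v (Icc (s i.castSucc) (s i.succ)) t‖ ≤ C := by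
    intro i
    apply isCompact_Icc.exists_bound_of_continuousOn
    exact (hC i).continuousOn_derivWithin
      (uniqueDiffOn_Icc (hs (Fin.castSucc_lt_succ))) (by norm_num)
  choose C hCb using hb
  refine ⟨hc, range s, ∑ i, |C i|, finite_range s, by positivity, ?_⟩
  rintro t ⟨ht, hts⟩
  obtain ⟨i, hi1, hi2⟩ := exists_piece s (h0 ▸ ht.1) (h1 ▸ ht.2)
  have hi1 := lt_of_le_of_ne hi1 (fun h => hts ⟨_, h⟩)
  have hi2 := lt_of_le_of_ne hi2 (fun h => hts ⟨_, h.symm⟩)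
  have hnh := Icc_mem_nhds hi1 hi2
  have hd : DifferentiableAt ℝ v t :=
    ((hC i).differentiableOn (by norm_num) t ⟨hi1.le, hi2.le⟩).differentiableAt hnh
  refine ⟨hd.hasDerivAt, ?_⟩
  rw [← derivWithin_of_mem_nhds hnh]
  exact ((hCb i t ⟨hi1.le, hi2.le⟩).trans (le_abs_self _)).trans
    (Finset.single_le_sum (f := fun i => |C i|) (fun i _ => abs_nonneg _) (Finset.mem_univ i))

end PartD

end FileD

section FileE

open Set Filter Topology MeasureTheory

open scoped RealInnerProductSpace

section PartE

variable {E : Type*} [NormedAddCommGroup E] [InnerProductSpace ℝ E]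
  {τ : ℝ} {R : ℝ → E →L[ℝ] E} {E₀ : Submodule ℝ E} {Q : E →ₗ[ℝ] E →ₗ[ℝ] ℝ} {U W : ℝ → E →L[ℝ] E}

/-- nonsingularity of `U` at a point -/
def NonSing (U : ℝ → E →L[ℝ] E) (t : ℝ) : Prop := ∀ e, U t e = 0 → e = 0

theorem NonSing.isUnit [FiniteDimensional ℝ E] {t : ℝ} (h : NonSing U t) : IsUnit (U t) := by
  have : CompleteSpace E := FiniteDimensional.complete ℝ E
  rw [ContinuousLinearMap.isUnit_iff_bijective]
  have hi : Function.Injective (U t : E →ₗ[ℝ] E) := by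
    rw [injective_iff_map_eq_zero]
    exact h
  exact ⟨hi, (LinearMap.injective_iff_surjective.1 hi)⟩

theorem JacobiPair.hasDerivAt_S [FiniteDimensional ℝ E] (J : JacobiPair τ R E₀ Q U W) {t : ℝ}
    (ht : t ∈ Icc 0 τ) (hn : NonSing U t) :
    HasDerivAt (fun t => W t * Ring.inverse (U t))
      (-(R t) - (W t * Ring.inverse (U t)) * (W t * Ring.inverse (U t))) t := by
  have : CompleteSpace E := FiniteDimensional.complete ℝ E
  obtain ⟨u, hu⟩ := hn.isUnit
  have h1 := hasFDerivAt_ringInverse (𝕜 := ℝ) u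
  rw [hu] at h1
  have h2 := (J.hW t ht).mul (h1.comp_hasDerivAt t (J.hU t ht))
  refine h2.congr_deriv ?_
  have h3 : Ring.inverse (U t) = ↑u⁻¹ := by rw [← hu, Ring.inverse_unit]
  have h4 : U t * ↑u⁻¹ = 1 := by rw [← hu]; simp
  have h5 : -(R t ∘L U t) * (↑u⁻¹ : E →L[ℝ] E) = - R t := by
    change -(R t * U t) * (↑u⁻¹ : E →L[ℝ] E) = - R t
    rw [neg_mul, mul_assoc, h4, mul_one]
  simp only [Function.comp_apply, h3, h5]
  simp [mul_assoc, sub_eq_add_neg]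

theorem picone_reg [FiniteDimensional ℝ E] (J : JacobiPair τ R E₀ Q U W)
    (hRcont : ContinuousOn R (Icc 0 τ)) {α β : ℝ} (hα : 0 ≤ α) (hab : α ≤ β) (hβ : β ≤ τ)
    (hn : ∀ t ∈ Icc α β, NonSing U t) {v v' : ℝ → E} (hv : Adm α β v v')
    {e f : E} (he : U α e = v α) (hf : U β f = v β) :
    ⟪W β f, v β⟫ - ⟪W α e, v α⟫ ≤ ∫ t in α..β, qf R v v' t := by
  have hsub : Icc α β ⊆ Icc 0 τ := Icc_subset_Icc hα hβ
  have hRc := hRcont.mono hsub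
  set S : ℝ → E →L[ℝ] E := fun t => W t * Ring.inverse (U t) with hS
  have hSd : ∀ t ∈ Icc α β, HasDerivAt S (-(R t) - S t * S t) t := fun t ht =>
    J.hasDerivAt_S (hsub ht) (hn t ht)
  have hSc : ContinuousOn S (Icc α β) := fun t ht => (hSd t ht).continuousAt.continuousWithinAt
  have hSU : ∀ t ∈ Icc α β, ∀ e, S t (U t e) = W t e := by
    intro t ht e
    have : (S t * U t) = W t := by
      rw [hS]; beta_reduce
      rw [mul_assoc, Ring.inverse_mul_cancel _ (hn t ht).isUnit, mul_one]
    exact congrArg (fun A : E →L[ℝ] E => A e) this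
  have hUs : ∀ t ∈ Icc α β, ∀ x, ∃ e, U t e = x := by
    intro t ht x
    refine ⟨Ring.inverse (U t) x, ?_⟩
    exact congrArg (fun A : E →L[ℝ] E => A x) (Ring.mul_inverse_cancel _ (hn t ht).isUnit)
  have hsym : ∀ t ∈ Icc α β, ∀ x y, ⟪S t x, y⟫ = ⟪x, S t y⟫ := by
    intro t ht x y
    obtain ⟨a, rfl⟩ := hUs t ht x
    obtain ⟨b, rfl⟩ := hUs t ht y
    rw [hSU t ht, hSU t ht, J.lag t (hsub ht)]
  have hαI : α ∈ Icc α β := ⟨le_rfl, hab⟩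
  have hβI : β ∈ Icc α β := ⟨hab, le_rfl⟩
  rw [← hSU α hαI, ← hSU β hβI, he, hf]
  obtain ⟨P, C, hP, hC, hd⟩ := hv.der
  let g : ℝ → ℝ := fun t => qf R v v' t - ⟪v' t - S t (v t), v' t - S t (v t)⟫
  have hSv : ContinuousOn (fun t => S t (v t)) (Icc α β) := hSc.clm_apply hv.cont
  have hgbm : BM α β g :=
    (qf_bm hRc hv).sub ((hv.bm.sub (BM.of_cont hSv)).inner (hv.bm.sub (BM.of_cont hSv)))
  have hint := integral_eq_of_hasDerivAt_off_countable_of_le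
    (fun t => ⟪S t (v t), v t⟫) g hab hP.countable (hSv.inner hv.cont) (by
      intro t ht
      have htI := Ioo_subset_Icc_self ht.1
      have h1 := (hd t ht).1
      have h2 := ((hSd t htI).clm_apply h1).inner ℝ h1
      refine h2.congr_deriv ?_
      simp only [g, qf]
      simp only [ContinuousLinearMap.sub_apply, ContinuousLinearMap.neg_apply, inner_sub_left,
        inner_sub_right, inner_add_left, inner_neg_left]
      have e1 : ⟪(S t * S t) (v t), v t⟫ = ⟪S t (v t), S t (v t)⟫ := by
        rw [← hsym t htI]; rfl
      have e2 : ⟪S t (v' t), v t⟫ = ⟪S t (v t), v' t⟫ := by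
        rw [hsym t htI, real_inner_comm]
      rw [e1, e2, real_inner_comm (S t (v t)) (v' t)]
      ring) (hgbm.intervalIntegrable hab)
  rw [← hint]
  apply intervalIntegral.integral_mono_on hab (hgbm.intervalIntegrable hab)
    ((qf_bm hRc hv).intervalIntegrable hab)
  intro t _
  simp only [g]
  have : 0 ≤ ⟪v' t - S t (v t), v' t - S t (v t)⟫ := real_inner_self_nonneg
  linarith

/-- upper bound for the energy of linear test functions -/
theorem test_bound [FiniteDimensional ℝ E] {α β M : ℝ} (hab : α < β)
    (hRc : ContinuousOn R (Icc α β)) (hM : ∀ t ∈ Icc α β, ‖R t‖ ≤ M) (x : E) (φ : ℝ → ℝ) (k : ℝ)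
    (hφ : ∀ t, HasDerivAt φ k t) (hφ1 : ∀ t ∈ Icc α β, |φ t| ≤ 1) (hk : |k| ≤ 1 / (β - α)) :
    Adm α β (fun t => φ t • x) (fun _ => k • x) ∧
    ∫ t in α..β, qf R (fun t => φ t • x) (fun _ => k • x) t
      ≤ ‖x‖ ^ 2 * (1 / (β - α) + M * (β - α)) := by
  have hA : Adm α β (fun t => φ t • x) (fun _ => k • x) :=
    Adm.of_hasDerivAt (fun t _ => (hφ t).smul_const x) continuousOn_const
  refine ⟨hA, ?_⟩
  have hpos : 0 < β - α := by linarith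
  have : ∫ t in α..β, qf R (fun t => φ t • x) (fun _ => k • x) t ≤
      ∫ t in α..β, ((1 / (β - α)) ^ 2 * ‖x‖ ^ 2 + M * ‖x‖ ^ 2) := by
    apply intervalIntegral.integral_mono_on hab.le ((qf_bm hRc hA).intervalIntegrable hab.le)
      (by simp)
    intro t ht
    rw [qf]
    have h1 : ⟪k • x, k • x⟫ ≤ (1 / (β - α)) ^ 2 * ‖x‖ ^ 2 := by
      rw [real_inner_self_eq_norm_sq, norm_smul, mul_pow]
      gcongr
      exact hk
    have h2 : -⟪R t (φ t • x), φ t • x⟫ ≤ M * ‖x‖ ^ 2 := by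
      have hn : ‖φ t • x‖ ≤ ‖x‖ := by
        rw [norm_smul]
        exact mul_le_of_le_one_left (norm_nonneg _) (hφ1 t ht)
      calc -⟪R t (φ t • x), φ t • x⟫ ≤ ‖R t (φ t • x)‖ * ‖φ t • x‖ :=
            (neg_le_abs _).trans (abs_real_inner_le_norm _ _)
        _ ≤ (‖R t‖ * ‖φ t • x‖) * ‖φ t • x‖ := by gcongr; exact (R t).le_opNorm _
        _ ≤ (M * ‖x‖) * ‖x‖ := by
          have := hM t ht
          have := (norm_nonneg _).trans this
          gcongr
        _ = _ := by ring
    linarith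
  refine this.trans (le_of_eq ?_)
  rw [intervalIntegral.integral_const]
  simp only [smul_eq_mul]
  field_simp

theorem S_lower [FiniteDimensional ℝ E] (J : JacobiPair τ R E₀ Q U W)
    (hRcont : ContinuousOn R (Icc 0 τ)) {M : ℝ} (hM : ∀ t ∈ Icc 0 τ, ‖R t‖ ≤ M)
    {t b : ℝ} (h0 : 0 ≤ t) (htb : t < b) (hb : b ≤ τ)
    (hn : ∀ s ∈ Icc t b, NonSing U s) (e : E) :
    -⟪W t e, U t e⟫ ≤ ‖U t e‖ ^ 2 * (1 / (b - t) + M * (b - t)) := by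
  have hsub : Icc t b ⊆ Icc 0 τ := Icc_subset_Icc h0 hb
  have hpos : 0 < b - t := by linarith
  obtain ⟨hA, hB⟩ := test_bound htb (hRcont.mono hsub) (fun s hs => hM s (hsub hs)) (U t e)
    (fun s => (b - s) / (b - t)) (-1 / (b - t))
    (fun s => ((hasDerivAt_id s).const_sub b).div_const (b - t))
    (fun s hs => by
      rw [abs_of_nonneg (div_nonneg (by linarith [hs.2]) hpos.le), div_le_one hpos]
      linarith [hs.1])
    (by rw [abs_div, abs_neg, abs_one, abs_of_pos hpos])
  have := picone_reg J hRcont h0 htb.le hb hn hA (e := e) (f := 0)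
    (by rw [div_self hpos.ne', one_smul]) (by simp)
  refine le_trans ?_ (this.trans hB)
  simp [div_self hpos.ne']

theorem S_upper [FiniteDimensional ℝ E] (J : JacobiPair τ R E₀ Q U W)
    (hRcont : ContinuousOn R (Icc 0 τ)) {M : ℝ} (hM : ∀ t ∈ Icc 0 τ, ‖R t‖ ≤ M)
    {t b : ℝ} (h0 : 0 ≤ b) (htb : b < t) (hb : t ≤ τ)
    (hn : ∀ s ∈ Icc b t, NonSing U s) (e : E) :
    ⟪W t e, U t e⟫ ≤ ‖U t e‖ ^ 2 * (1 / (t - b) + M * (t - b)) := by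
  have hsub : Icc b t ⊆ Icc 0 τ := Icc_subset_Icc h0 hb
  have hpos : 0 < t - b := by linarith
  obtain ⟨hA, hB⟩ := test_bound htb (hRcont.mono hsub) (fun s hs => hM s (hsub hs)) (U t e)
    (fun s => (s - b) / (t - b)) (1 / (t - b))
    (fun s => ((hasDerivAt_id s).sub_const b).div_const (t - b))
    (fun s hs => by
      rw [abs_of_nonneg (div_nonneg (by linarith [hs.1]) hpos.le), div_le_one hpos]
      linarith [hs.2])
    (by rw [abs_div, abs_one, abs_of_pos hpos])
  have := picone_reg J hRcont h0 htb.le hb hn hA (e := 0) (f := e)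
    (by simp) (by rw [div_self hpos.ne', one_smul])
  refine le_trans ?_ (this.trans hB)
  simp [div_self hpos.ne']

end PartE

end FileE

section FileF

open Set Filter Topology MeasureTheory

open scoped RealInnerProductSpace

section PartF

variable {E : Type*} [NormedAddCommGroup E] [InnerProductSpace ℝ E]
  {τ : ℝ} {R : ℝ → E →L[ℝ] E} {E₀ : Submodule ℝ E} {Q : E →ₗ[ℝ] E →ₗ[ℝ] ℝ} {U W : ℝ → E →L[ℝ] E}

theorem NonSing.surj [FiniteDimensional ℝ E] {t : ℝ} (h : NonSing U t) (x : E) : ∃ e, U t e = x :=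
  ⟨Ring.inverse (U t) x,
    congrArg (fun A : E →L[ℝ] E => A x) (Ring.mul_inverse_cancel _ h.isUnit)⟩

theorem JacobiPair.expand (J : JacobiPair τ R E₀ Q U W) {t : ℝ} (ht : t ∈ Icc 0 τ) (g f : E) :
    ⟪W t g, U t g⟫ = ⟪W t f, U t f⟫ + 2 * ⟪W t f, U t g - U t f⟫ +
      ⟪W t (g - f), U t (g - f)⟫ := by
  have h := J.lag t ht f g
  have h2 : ⟪W t g, U t f⟫ = ⟪W t f, U t g⟫ := by rw [← h, real_inner_comm]
  simp only [map_sub, inner_sub_left, inner_sub_right]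
  rw [h2]
  ring

theorem picone_right [FiniteDimensional ℝ E] (J : JacobiPair τ R E₀ Q U W)
    (hRcont : ContinuousOn R (Icc 0 τ)) {α β : ℝ} (hα : 0 ≤ α) (hab : α < β) (hβ : β ≤ τ)
    (hn : ∀ t ∈ Ico α β, NonSing U t) {v v' : ℝ → E} (hv : Adm α β v v')
    {e f : E} (he : U α e = v α) (hf : U β f = v β) :
    ⟪W β f, v β⟫ - ⟪W α e, v α⟫ ≤ ∫ t in α..β, qf R v v' t := by
  have hsub : Icc α β ⊆ Icc 0 τ := Icc_subset_Icc hα hβ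
  obtain ⟨M, hM⟩ := (isCompact_Icc (a := 0) (b := τ)).exists_bound_of_continuousOn hRcont
  have hUf : Adm α β (fun t => U t f) (fun t => W t f) :=
    Adm.of_hasDerivAt (fun t ht => J.hUe (hsub ht) f)
      (fun t ht => (J.hWe (hsub ht) f).continuousAt.continuousWithinAt)
  obtain ⟨C, hC, hLip⟩ := (hv.sub hUf).lipschitz
  have hM0 : 0 ≤ M := (norm_nonneg _).trans (hM α (hsub ⟨le_rfl, hab.le⟩))
  let H : ℝ → ℝ := fun t => ⟪W t f, U t f⟫ + 2 * ⟪W t f, v t - U t f⟫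
    - C ^ 2 * (2 * (β - t) + M * (β - t) ^ 3) - ⟪W α e, v α⟫
  have hβI : β ∈ Icc α β := ⟨hab.le, le_rfl⟩
  have cU : ContinuousOn (fun t => U t f) (Icc α β) := hUf.cont
  have cW : ContinuousOn (fun t => W t f) (Icc α β) :=
    fun t ht => (J.hWe (hsub ht) f).continuousAt.continuousWithinAt
  have cv := hv.cont
  have hHc : ContinuousOn H (Icc α β) := by
    have : ContinuousOn (fun t => C ^ 2 * (2 * (β - t) + M * (β - t) ^ 3)) (Icc α β) := by fun_prop
    exact (((cW.inner cU).add ((cW.inner (cv.sub cU)).const_mul 2)).sub this).sub continuousOn_const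
  have hic : ContinuousOn (fun t => ∫ s in α..t, qf R v v' s) (Icc α β) := by
    have := intervalIntegral.continuousOn_primitive_interval'
      ((qf_bm (hRcont.mono hsub) hv).intervalIntegrable hab.le) left_mem_uIcc
    rwa [uIcc_of_le hab.le] at this
  have hlim : H β ≤ ∫ s in α..β, qf R v v' s := by
    refine ContinuousWithinAt.closure_le (s := Ioo α β) (f := H)
      (g := fun t => ∫ s in α..t, qf R v v' s) ?_ ((hHc β hβI).mono Ioo_subset_Icc_self)
      ((hic β hβI).mono Ioo_subset_Icc_self) ?_
    · rw [closure_Ioo hab.ne]; exact hβI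
    intro t ht
    have htI := Ioo_subset_Icc_self ht
    obtain ⟨g, hg⟩ := (hn t ⟨ht.1.le, ht.2⟩).surj (v t)
    have h1 := picone_reg J hRcont hα ht.1.le (ht.2.le.trans hβ)
      (fun s hs => hn s ⟨hs.1, hs.2.trans_lt ht.2⟩) (hv.mono le_rfl ht.2.le) he hg
    have h2 := J.expand (hsub htI) g f
    have h3 := S_lower J hRcont hM (hsub htI).1 (show t < (t + β) / 2 by linarith [ht.2])
      (by linarith [ht.2]) (fun s hs => hn s ⟨ht.1.le.trans hs.1, by linarith [hs.2, ht.2]⟩) (g - f)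
    have h4 : ‖U t (g - f)‖ ≤ C * (β - t) := by
      have := hLip t β ht.1.le ht.2.le le_rfl
      beta_reduce at this
      rw [hf, sub_self, zero_sub, norm_neg, ← hg, ← map_sub] at this
      exact this
    have h5 : 0 < β - t := by linarith [ht.2]
    have h6 : ‖U t (g - f)‖ ^ 2 * (1 / ((t + β) / 2 - t) + M * ((t + β) / 2 - t)) ≤
        C ^ 2 * (2 * (β - t) + M * (β - t) ^ 3) := by
      have e1 : (t + β) / 2 - t = (β - t) / 2 := by ring
      rw [e1]
      calc _ ≤ (C * (β - t)) ^ 2 * (1 / ((β - t) / 2) + M * (β - t)) := by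
            gcongr
            linarith
        _ = _ := by field_simp
    simp only [H]
    rw [hg] at h2
    linarith
  refine le_trans (le_of_eq ?_) hlim
  simp only [H, hf]
  simp

theorem picone_left [FiniteDimensional ℝ E] (J : JacobiPair τ R E₀ Q U W)
    (hRcont : ContinuousOn R (Icc 0 τ)) {α β : ℝ} (hα : 0 ≤ α) (hab : α < β) (hβ : β ≤ τ)
    (hn : ∀ t ∈ Ioc α β, NonSing U t) {v v' : ℝ → E} (hv : Adm α β v v')
    {e f : E} (he : U α e = v α) (hf : U β f = v β) :
    ⟪W β f, v β⟫ - ⟪W α e, v α⟫ ≤ ∫ t in α..β, qf R v v' t := by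
  have hsub : Icc α β ⊆ Icc 0 τ := Icc_subset_Icc hα hβ
  obtain ⟨M, hM⟩ := (isCompact_Icc (a := 0) (b := τ)).exists_bound_of_continuousOn hRcont
  have hUf : Adm α β (fun t => U t e) (fun t => W t e) :=
    Adm.of_hasDerivAt (fun t ht => J.hUe (hsub ht) e)
      (fun t ht => (J.hWe (hsub ht) e).continuousAt.continuousWithinAt)
  obtain ⟨C, hC, hLip⟩ := (hv.sub hUf).lipschitz
  have hM0 : 0 ≤ M := (norm_nonneg _).trans (hM α (hsub ⟨le_rfl, hab.le⟩))
  let H : ℝ → ℝ := fun t => ⟪W β f, v β⟫ - (⟪W t e, U t e⟫ + 2 * ⟪W t e, v t - U t e⟫)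
    - C ^ 2 * (2 * (t - α) + M * (t - α) ^ 3)
  have hαI : α ∈ Icc α β := ⟨le_rfl, hab.le⟩
  have cU : ContinuousOn (fun t => U t e) (Icc α β) := hUf.cont
  have cW : ContinuousOn (fun t => W t e) (Icc α β) :=
    fun t ht => (J.hWe (hsub ht) e).continuousAt.continuousWithinAt
  have cv := hv.cont
  have hHc : ContinuousOn H (Icc α β) := by
    have : ContinuousOn (fun t => C ^ 2 * (2 * (t - α) + M * (t - α) ^ 3)) (Icc α β) := by fun_prop
    exact (continuousOn_const.sub
      ((cW.inner cU).add ((cW.inner (cv.sub cU)).const_mul 2))).sub this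
  have hii := (qf_bm (hRcont.mono hsub) hv).intervalIntegrable hab.le
  have hic : ContinuousOn (fun t => (∫ s in α..β, qf R v v' s) - ∫ s in α..t, qf R v v' s)
      (Icc α β) := by
    have := intervalIntegral.continuousOn_primitive_interval' hii left_mem_uIcc
    rw [uIcc_of_le hab.le] at this
    exact continuousOn_const.sub this
  have hlim : H α ≤ (∫ s in α..β, qf R v v' s) - ∫ s in α..α, qf R v v' s := by
    refine ContinuousWithinAt.closure_le (s := Ioo α β) (f := H)
      (g := fun t => (∫ s in α..β, qf R v v' s) - ∫ s in α..t, qf R v v' s) ?_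
      ((hHc α hαI).mono Ioo_subset_Icc_self)
      ((hic α hαI).mono Ioo_subset_Icc_self) ?_
    · rw [closure_Ioo hab.ne]; exact hαI
    intro t ht
    have htI := Ioo_subset_Icc_self ht
    obtain ⟨g, hg⟩ := (hn t ⟨ht.1, ht.2.le⟩).surj (v t)
    have h1 := picone_reg J hRcont (hα.trans ht.1.le) ht.2.le hβ
      (fun s hs => hn s ⟨ht.1.trans_le hs.1, hs.2⟩) (hv.mono ht.1.le le_rfl) hg hf
    have h2 := J.expand (hsub htI) g e
    have h3 := S_upper J hRcont hM (by linarith [ht.1]) (show (t + α) / 2 < t by linarith [ht.1])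
      (hsub htI).2 (fun s hs => hn s ⟨by linarith [hs.1, ht.1], hs.2.trans ht.2.le⟩) (g - e)
    have h4 : ‖U t (g - e)‖ ≤ C * (t - α) := by
      have := hLip α t le_rfl ht.1.le ht.2.le
      beta_reduce at this
      rw [he, sub_self, sub_zero, ← hg, ← map_sub] at this
      exact this
    have h5 : 0 < t - α := by linarith [ht.1]
    have h6 : ‖U t (g - e)‖ ^ 2 * (1 / (t - (t + α) / 2) + M * (t - (t + α) / 2)) ≤
        C ^ 2 * (2 * (t - α) + M * (t - α) ^ 3) := by
      have e1 : t - (t + α) / 2 = (t - α) / 2 := by ring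
      rw [e1]
      calc _ ≤ (C * (t - α)) ^ 2 * (1 / ((t - α) / 2) + M * (t - α)) := by
            gcongr
            linarith
        _ = _ := by field_simp
    have h7 : (∫ s in α..β, qf R v v' s) - ∫ s in α..t, qf R v v' s = ∫ s in t..β, qf R v v' s := by
      rw [← intervalIntegral.integral_add_adjacent_intervals (b := t)
        (hii.mono_set (by rw [uIcc_of_le hab.le, uIcc_of_le ht.1.le]; exact Icc_subset_Icc_right ht.2.le))
        (hii.mono_set (by rw [uIcc_of_le hab.le, uIcc_of_le ht.2.le]; exact Icc_subset_Icc_left ht.1.le))]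
      ring
    simp only [H]
    rw [hg] at h2
    rw [h7]
    linarith
  rw [intervalIntegral.integral_same, sub_zero] at hlim
  refine le_trans (le_of_eq ?_) hlim
  simp only [H, he]
  simp

theorem picone_all [FiniteDimensional ℝ E] (J : JacobiPair τ R E₀ Q U W)
    (hRcont : ContinuousOn R (Icc 0 τ)) {v v' : ℝ → E} (hv : Adm 0 τ v v')
    (c : ℝ → E) (hc : ∀ t ∈ Icc 0 τ, U t (c t) = v t) (n : ℕ) :
    ∀ α β, 0 ≤ α → α < β → β ≤ τ →
    ({t | t ∈ Icc 0 τ ∧ ¬ NonSing U t} ∩ Ioo α β).ncard ≤ n →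
    ⟪W β (c β), v β⟫ - ⟪W α (c α), v α⟫ ≤ ∫ t in α..β, qf R v v' t := by
  have hF : {t | t ∈ Icc 0 τ ∧ ¬ NonSing U t}.Finite := by
    refine J.finite_singular.subset ?_
    rintro t ⟨h1, h2⟩
    refine ⟨h1, ?_⟩
    unfold NonSing at h2
    push Not at h2
    obtain ⟨e, h3, h4⟩ := h2
    exact ⟨e, h4, h3⟩
  set F := {t | t ∈ Icc 0 τ ∧ ¬ NonSing U t} with hFdef
  have split : ∀ α m β, 0 ≤ α → α < m → m < β → β ≤ τ →
      ∫ t in α..β, qf R v v' t = (∫ t in α..m, qf R v v' t) + ∫ t in m..β, qf R v v' t := by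
    intro α m β h1 h2 h3 h4
    have hii := fun (a b : ℝ) (h0 : 0 ≤ a) (hab : a ≤ b) (hb : b ≤ τ) =>
      (qf_bm (hRcont.mono (Icc_subset_Icc h0 hb)) (hv.mono h0 hb)).intervalIntegrable hab
    exact (intervalIntegral.integral_add_adjacent_intervals
      (hii α m h1 h2.le (h3.le.trans h4)) (hii m β (h1.trans h2.le) h3.le h4)).symm
  induction n with
  | zero =>
    intro α β h0 hab hb hcard
    have hem : F ∩ Ioo α β = ∅ := by
      rw [← Set.ncard_eq_zero (hF.subset inter_subset_left)]; omega
    have hns : ∀ t ∈ Ioo α β, NonSing U t := by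
      intro t ht
      by_contra h
      exact (hem ▸ (⟨⟨⟨h0.trans ht.1.le, ht.2.le.trans hb⟩, h⟩, ht⟩ : t ∈ F ∩ Ioo α β) :
        t ∈ (∅ : Set ℝ))
    have hm1 : α < (α + β) / 2 := by linarith
    have hm2 : (α + β) / 2 < β := by linarith
    rw [split α ((α + β) / 2) β h0 hm1 hm2 hb]
    have a1 := picone_left J hRcont h0 hm1 (hm2.le.trans hb)
      (fun t ht => hns t ⟨ht.1, ht.2.trans_lt hm2⟩) (hv.mono h0 (hm2.le.trans hb))
      (hc α ⟨h0, hab.le.trans hb⟩) (hc ((α + β) / 2) ⟨by linarith, by linarith⟩)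
    have a2 := picone_right J hRcont (h0.trans hm1.le) hm2 hb
      (fun t ht => hns t ⟨hm1.trans_le ht.1, ht.2⟩) (hv.mono (h0.trans hm1.le) hb)
      (hc ((α + β) / 2) ⟨by linarith, by linarith⟩) (hc β ⟨by linarith, hb⟩)
    linarith
  | succ n ih =>
    intro α β h0 hab hb hcard
    by_cases hem : (F ∩ Ioo α β).Nonempty
    · obtain ⟨m, hmF, hm⟩ := hem
      have hfin : (F ∩ Ioo α β).Finite := hF.subset inter_subset_left
      have key : ∀ s, s ⊆ F ∩ Ioo α β → m ∉ s → s.ncard ≤ n := by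
        intro s hs hms
        have : s.ncard < (F ∩ Ioo α β).ncard :=
          Set.ncard_lt_ncard ⟨hs, fun h => hms (h ⟨hmF, hm⟩)⟩ hfin
        omega
      rw [split α m β h0 hm.1 hm.2 hb]
      have a1 := ih α m h0 hm.1 (hm.2.le.trans hb) (key _
        (inter_subset_inter_right _ (Ioo_subset_Ioo_right hm.2.le)) (fun h => lt_irrefl _ h.2.2))
      have a2 := ih m β (h0.trans hm.1.le) hm.2 hb (key _
        (inter_subset_inter_right _ (Ioo_subset_Ioo_left hm.1.le)) (fun h => lt_irrefl _ h.2.1))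
      linarith
    · apply ih α β h0 hab hb
      rw [not_nonempty_iff_eq_empty.1 hem]
      simp

theorem indexForm_nonneg [FiniteDimensional ℝ E] (J : JacobiPair τ R E₀ Q U W) (hτ : 0 < τ)
    (hRcont : ContinuousOn R (Icc 0 τ)) {v v' : ℝ → E} (hv : Adm 0 τ v v')
    (h0 : v 0 ∈ E₀) (h1 : v τ = 0)
    (hc : ∀ t ∈ Ioo 0 τ, ¬ NonSing U t → ∃ e, U t e = v t) : 0 ≤ indexForm R Q τ v := by
  have hc' : ∀ t ∈ Icc 0 τ, ∃ e, U t e = v t := by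
    intro t ht
    by_cases hn : NonSing U t
    · exact hn.surj _
    rcases eq_or_lt_of_le ht.1 with h | h
    · subst h; exact J.range _ h0
    rcases eq_or_lt_of_le ht.2 with h' | h'
    · subst h'; exact ⟨0, by simp [h1]⟩
    · exact hc t ⟨h, h'⟩ hn
  choose! c hc using hc'
  rw [indexForm_eq hτ hv]
  have := picone_all J hRcont hv c hc _ 0 τ le_rfl hτ le_rfl le_rfl
  rw [h1, inner_zero_right, J.bdry _ _ h0, hc 0 ⟨le_rfl, hτ.le⟩] at this
  linarith

end PartF

end FileF

section FileG

open Set Filter Topology MeasureTheory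

open scoped RealInnerProductSpace

section PartG

variable {E : Type*} [NormedAddCommGroup E] [InnerProductSpace ℝ E]
  {τ : ℝ} {R : ℝ → E →L[ℝ] E} {E₀ : Submodule ℝ E} {Q : E →ₗ[ℝ] E →ₗ[ℝ] ℝ} {U W : ℝ → E →L[ℝ] E}

theorem morse_upper [FiniteDimensional ℝ E] (J : JacobiPair τ R E₀ Q U W) (hτ : 0 < τ)
    (hRcont : ContinuousOn R (Icc 0 τ)) (F : Finset ℝ)
    (hF : ∀ t ∈ Ioo 0 τ, ¬ NonSing U t → t ∈ F) {n : ℕ} (hn : n ∈ MorseIndexSet R E₀ Q τ) :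
    n ≤ ∑ a ∈ F, Module.finrank ℝ (LinearMap.ker (U a : E →ₗ[ℝ] E)) := by
  obtain ⟨v, hv, -, hneg⟩ := hn
  by_contra! hlt
  let Φ : (Fin n → ℝ) →ₗ[ℝ] ((a : F) → E ⧸ LinearMap.range (U a : E →ₗ[ℝ] E)) :=
    LinearMap.pi fun a => (LinearMap.range (U a : E →ₗ[ℝ] E)).mkQ ∘ₗ
      Fintype.linearCombination ℝ (fun i => v i a)
  have hdim : Module.finrank ℝ ((a : F) → E ⧸ LinearMap.range (U a : E →ₗ[ℝ] E)) =
      ∑ a ∈ F, Module.finrank ℝ (LinearMap.ker (U a : E →ₗ[ℝ] E)) := by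
    rw [Module.finrank_pi_fintype, ← Finset.sum_coe_sort F]
    refine Finset.sum_congr rfl fun a _ => ?_
    have h1 := (LinearMap.range (U a : E →ₗ[ℝ] E)).finrank_quotient_add_finrank
    have h2 := (U a : E →ₗ[ℝ] E).finrank_range_add_finrank_ker
    omega
  have hker : LinearMap.ker Φ ≠ ⊥ := LinearMap.ker_ne_bot_of_finrank_lt (by rw [hdim]; simpa using hlt)
  obtain ⟨c, hc, hc0⟩ := Submodule.exists_mem_ne_zero_of_ne_bot hker
  have hA : Adm 0 τ (fun t => ∑ i, c i • v i t) (fun t => ∑ i, c i • deriv (v i) t) :=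
    Adm.sum (v := fun i t => c i • v i t) (v' := fun i t => c i • deriv (v i) t) _
      fun i _ => (hv i).adm.smul (c i)
  have := hneg c hc0
  refine absurd this (not_lt.2 ?_)
  apply indexForm_nonneg J hτ hRcont hA
  · exact Submodule.sum_mem _ fun i _ => Submodule.smul_mem _ _ (hv i).2.1
  · exact Finset.sum_eq_zero fun i _ => by rw [(hv i).2.2.2, smul_zero]
  · intro t ht hns
    have h1 : Φ c = 0 := hc
    have h2 := congrFun h1 ⟨t, hF t ht hns⟩
    have h3 : (∑ i, c i • v i t) ∈ LinearMap.range (U t : E →ₗ[ℝ] E) := by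
      have h4 : (LinearMap.range (U t : E →ₗ[ℝ] E)).mkQ
          (Fintype.linearCombination ℝ (fun i => v i t) c) = 0 := h2
      rw [Fintype.linearCombination_apply] at h4
      exact (Submodule.Quotient.mk_eq_zero _).1 h4
    exact h3

end PartG

end FileG

section FileH

open Set Filter Topology MeasureTheory

open scoped RealInnerProductSpace

section PartH

variable {E : Type*} [NormedAddCommGroup E] [InnerProductSpace ℝ E]
  {τ : ℝ} {R : ℝ → E →L[ℝ] E} {E₀ : Submodule ℝ E} {Q : E →ₗ[ℝ] E →ₗ[ℝ] ℝ} {U W : ℝ → E →L[ℝ] E}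

open Classical in
/-- truncation at `a` -/
noncomputable def cut (a : ℝ) (U : ℝ → E →L[ℝ] E) (x : E) (t : ℝ) : E := if t ≤ a then U t x else 0

theorem cut_of_le {a t : ℝ} (h : t ≤ a) (x : E) : cut a U x t = U t x := if_pos h

theorem cut_of_ge {a t : ℝ} (h : a ≤ t) {x : E} (hx : U a x = 0) : cut a U x t = 0 := by
  unfold cut
  split_ifs with h1
  · rw [le_antisymm h1 h, hx]
  · rfl

theorem cut_adm (J : JacobiPair τ R E₀ Q U W) {a : ℝ} (ha : a ∈ Ioo 0 τ) {x : E}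
    (hx : U a x = 0) : Adm 0 τ (cut a U x) (cut a W x) := by
  have cU : ContinuousOn (fun t => U t x) (Icc 0 τ) :=
    fun t ht => (J.hUe ht x).continuousAt.continuousWithinAt
  have cW : ContinuousOn (fun t => W t x) (Icc 0 τ) :=
    fun t ht => (J.hWe ht x).continuousAt.continuousWithinAt
  obtain ⟨C, hC⟩ := isCompact_Icc.exists_bound_of_continuousOn cW
  have hC0 : 0 ≤ C := (norm_nonneg _).trans (hC 0 ⟨le_rfl, ha.1.le.trans ha.2.le⟩)
  refine ⟨?_, {a}, C, finite_singleton a, hC0, ?_⟩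
  · have : Icc 0 τ = Icc 0 a ∪ Icc a τ := (Icc_union_Icc_eq_Icc ha.1.le ha.2.le).symm
    rw [this]
    apply ContinuousOn.union_of_isClosed _ _ isClosed_Icc isClosed_Icc
    · exact (cU.mono (Icc_subset_Icc_right ha.2.le)).congr fun t ht => cut_of_le ht.2 x
    · exact (continuousOn_const (c := (0:E))).congr fun t ht => cut_of_ge ht.1 hx
  · rintro t ⟨ht, hta⟩
    rcases lt_or_gt_of_ne (show t ≠ a from hta) with h | h
    · rw [cut_of_le h.le]
      refine ⟨(J.hUe (Ioo_subset_Icc_self ht) x).congr_of_eventuallyEq ?_,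
        hC t (Ioo_subset_Icc_self ht)⟩
      filter_upwards [Iio_mem_nhds h] with s hs using cut_of_le (le_of_lt hs) x
    · have : cut a W x t = 0 := if_neg (not_le.2 h)
      rw [this]
      refine ⟨(hasDerivAt_const t (0:E)).congr_of_eventuallyEq ?_, by simpa using hC0⟩
      filter_upwards [Ioi_mem_nhds h] with s hs using cut_of_ge (le_of_lt hs) hx

theorem cut_form [FiniteDimensional ℝ E] (J : JacobiPair τ R E₀ Q U W)
    (hRcont : ContinuousOn R (Icc 0 τ)) {a : ℝ} (ha : a ∈ Ioo 0 τ) {x : E}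
    (hx : U a x = 0) {y y' : ℝ → E} (hy : Adm 0 τ y y') (hy0 : y 0 ∈ E₀) :
    -(Q (U 0 x) (y 0)) + ∫ t in (0:ℝ)..τ, qb R (cut a U x) (cut a W x) y y' t = ⟪W a x, y a⟫ := by
  have hA := cut_adm J ha hx
  have hsub1 : Icc 0 a ⊆ Icc 0 τ := Icc_subset_Icc_right ha.2.le
  have i1 := (qb_bm (hRcont.mono hsub1) (hA.mono le_rfl ha.2.le)
    (hy.mono le_rfl ha.2.le)).intervalIntegrable ha.1.le
  have i2 := (qb_bm (hRcont.mono (Icc_subset_Icc_left ha.1.le)) (hA.mono ha.1.le le_rfl)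
    (hy.mono ha.1.le le_rfl)).intervalIntegrable ha.2.le
  rw [← intervalIntegral.integral_add_adjacent_intervals i1 i2]
  have z2 : ∫ t in a..τ, qb R (cut a U x) (cut a W x) y y' t = 0 := by
    rw [intervalIntegral.integral_of_le ha.2.le]
    apply integral_eq_zero_of_ae
    filter_upwards [ae_restrict_mem measurableSet_Ioc] with t ht
    have h1 : cut a U x t = 0 := if_neg (not_le.2 ht.1)
    have h2 : cut a W x t = 0 := if_neg (not_le.2 ht.1)
    simp [qb, h1, h2]
  have cW : ContinuousOn (fun t => W t x) (Icc 0 a) :=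
    fun t ht => (J.hWe (hsub1 ht) x).continuousAt.continuousWithinAt
  obtain ⟨P, C, hP, hC, hd⟩ := hy.der
  have z1 := integral_eq_of_hasDerivAt_off_countable_of_le
    (fun t => ⟪W t x, y t⟫) (qb R (cut a U x) (cut a W x) y y') ha.1.le hP.countable
    (cW.inner (hy.cont.mono hsub1)) (by
      intro t ht
      have h1 := (hd t ⟨⟨ht.1.1, ht.1.2.trans ha.2⟩, ht.2⟩).1
      have h2 := (J.hWe (hsub1 (Ioo_subset_Icc_self ht.1)) x).inner ℝ h1
      refine h2.congr_deriv ?_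
      rw [qb, cut_of_le ht.1.2.le, cut_of_le ht.1.2.le, inner_neg_left]
      ring) i1
  rw [z1, z2, J.bdry x _ hy0]
  ring

theorem exists_psi (F : Finset ℝ) (hF : ∀ a ∈ F, a ∈ Ioo 0 τ) (a : ℝ) (ha : a ∈ F) :
    ∃ p : Polynomial ℝ, p.eval a = 1 ∧ (∀ b ∈ F, b ≠ a → p.eval b = 0) ∧ p.eval 0 = 0 ∧
      p.derivative.eval 0 = 0 ∧ p.eval τ = 0 := by
  classical
  let q : Polynomial ℝ := (Polynomial.X - Polynomial.C τ) *
    ∏ b ∈ F.erase a, (Polynomial.X - Polynomial.C b)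
  have hq : (a ^ 2 * q.eval a) ≠ 0 := by
    simp only [q, Polynomial.eval_mul, Polynomial.eval_prod, Polynomial.eval_sub,
      Polynomial.eval_X, Polynomial.eval_C]
    refine mul_ne_zero (pow_ne_zero _ (hF a ha).1.ne') (mul_ne_zero ?_ ?_)
    · exact sub_ne_zero.2 (hF a ha).2.ne
    · rw [Finset.prod_ne_zero_iff]
      intro b hb
      exact sub_ne_zero.2 (Finset.ne_of_mem_erase hb).symm
  refine ⟨Polynomial.C (a ^ 2 * q.eval a)⁻¹ * (Polynomial.X ^ 2 * q), ?_, ?_, ?_, ?_, ?_⟩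
  · simp only [Polynomial.eval_mul, Polynomial.eval_C, Polynomial.eval_pow, Polynomial.eval_X]
    exact inv_mul_cancel₀ hq
  · intro b hb hba
    have : q.eval b = 0 := by
      simp only [q, Polynomial.eval_mul, Polynomial.eval_prod, Polynomial.eval_sub,
        Polynomial.eval_X, Polynomial.eval_C]
      rw [Finset.prod_eq_zero (Finset.mem_erase.2 ⟨hba, hb⟩) (by simp), mul_zero]
    simp [this]
  · simp
  · simp
  · have : q.eval τ = 0 := by simp [q]
    simp [this]

theorem z_inOmega (J : JacobiPair τ R E₀ Q U W) (hRcont : ContinuousOn R (Icc 0 τ))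
    {a : ℝ} (ha : a ∈ Ioo 0 τ) {x : E}
    (hx : U a x = 0) (p : Polynomial ℝ) (h0 : p.eval 0 = 0) (h0' : p.derivative.eval 0 = 0)
    (hp : p.eval τ = 0) (η : E) : InOmega E₀ Q τ (fun t => cut a U x t + p.eval t • η) := by
  have hψ : ContDiff ℝ 2 (fun t => p.eval t • η) := by
    apply ContDiff.smul _ contDiff_const
    simpa using p.contDiff_aeval (𝕜 := ℝ) 2
  have hz0 : HasDerivAt (fun t => cut a U x t + p.eval t • η) (W 0 x) 0 := by
    have h1 : HasDerivAt (cut a U x) (W 0 x) 0 := by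
      refine (J.hUe ⟨le_rfl, ha.1.le.trans ha.2.le⟩ x).congr_of_eventuallyEq ?_
      filter_upwards [Iio_mem_nhds ha.1] with s hs using cut_of_le (le_of_lt hs) x
    have h2 := h1.add ((p.hasDerivAt 0).smul_const η)
    exact h2.congr_deriv (by rw [h0', zero_smul, add_zero])
  have h00 : cut a U x 0 + p.eval 0 • η = U 0 x := by
    rw [cut_of_le ha.1.le, h0, zero_smul, add_zero]
  refine ⟨⟨(cut_adm J ha hx).cont.add hψ.continuous.continuousOn, 2, ![0, a, τ], ?_, rfl, rfl, ?_⟩,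
    ?_, ?_, ?_⟩
  · rw [Fin.strictMono_iff_lt_succ]
    intro i
    fin_cases i
    · exact ha.1
    · exact ha.2
  · intro i
    fin_cases i
    · change ContDiffOn ℝ 2 _ (Icc 0 a)
      have hsub : Icc 0 a ⊆ Icc 0 τ := Icc_subset_Icc_right ha.2.le
      have h1 : ContDiffOn ℝ 2 (fun t => U t x) (Icc 0 a) :=
        contDiffOn_two_of ha.1 (fun t ht => J.hUe (hsub ht) x) (fun t ht => J.hWe (hsub ht) x)
          (((hRcont.mono hsub).clm_apply
            (fun t ht => (J.hUe (hsub ht) x).continuousAt.continuousWithinAt)).neg)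
      exact (h1.add hψ.contDiffOn).congr fun t ht => by rw [cut_of_le ht.2]
    · change ContDiffOn ℝ 2 _ (Icc a τ)
      exact hψ.contDiffOn.congr fun t ht => by rw [cut_of_ge ht.1 hx, zero_add]
  · beta_reduce
    rw [h00]; exact J.mem x
  · intro w hw
    rw [hz0.hasDerivWithinAt.derivWithin
      (uniqueDiffOn_Icc (ha.1.trans ha.2) 0 ⟨le_rfl, ha.1.le.trans ha.2.le⟩)]
    beta_reduce
    rw [h00]
    exact J.bdry x w hw
  · beta_reduce
    rw [cut_of_ge ha.2.le hx, hp, zero_smul, add_zero]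

end PartH

end FileH

section FileI

open Set Filter Topology MeasureTheory

open scoped RealInnerProductSpace

section PartI

variable {E : Type*} [NormedAddCommGroup E] [InnerProductSpace ℝ E]
  {τ : ℝ} {R : ℝ → E →L[ℝ] E} {E₀ : Submodule ℝ E} {Q : E →ₗ[ℝ] E →ₗ[ℝ] ℝ} {U W : ℝ → E →L[ℝ] E}

theorem neg_form [FiniteDimensional ℝ E] (J : JacobiPair τ R E₀ Q U W) (hτ : 0 < τ)
    (hRcont : ContinuousOn R (Icc 0 τ))
    (hRsa : ∀ t ∈ Set.Icc (0:ℝ) τ, ∀ u v : E, ⟪R t u, v⟫ = ⟪u, R t v⟫)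
    (F : Finset ℝ) (hF : ∀ a ∈ F, a ∈ Ioo 0 τ) (p : F → Polynomial ℝ)
    (h1 : ∀ a, (p a).eval (a:ℝ) = 1) (h2 : ∀ a b : F, b ≠ a → (p a).eval (b:ℝ) = 0)
    (h3 : ∀ a, (p a).eval 0 = 0) :
    ∃ ε : ℝ, ∀ ξ : F → E, (∀ a : F, U a (ξ a) = 0) → ξ ≠ 0 →
      indexForm R Q τ (fun t => ∑ a : F, (cut a U (ξ a) t + (p a).eval t • ((-ε) • W a (ξ a)))) < 0 := by
  obtain ⟨M, hM⟩ := (isCompact_Icc (a := 0) (b := τ)).exists_bound_of_continuousOn hRcont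
  have hM0 : 0 ≤ M := (norm_nonneg _).trans (hM 0 ⟨le_rfl, hτ.le⟩)
  have hbd : ∀ q : Polynomial ℝ, ∃ C, ∀ t ∈ Icc 0 τ, ‖q.eval t‖ ≤ C := fun q =>
    isCompact_Icc.exists_bound_of_continuousOn q.continuous.continuousOn
  choose C hC using hbd
  let D : ℝ := ∑ a : F, (|C (p a)| + |C (p a).derivative|)
  have hD0 : 0 ≤ D := by positivity
  have hDa : ∀ a : F, |C (p a)| + |C (p a).derivative| ≤ D := fun a =>
    Finset.single_le_sum (f := fun a : F => |C (p a)| + |C (p a).derivative|)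
      (fun i _ => by positivity) (Finset.mem_univ a)
  have hD1 : ∀ a : F, ∀ t ∈ Icc 0 τ, |(p a).eval t| ≤ D := fun a t ht => by
    have := hC (p a) t ht
    rw [Real.norm_eq_abs] at this
    linarith [hDa a, le_abs_self (C (p a)), abs_nonneg (C (p a).derivative)]
  have hD2 : ∀ a : F, ∀ t ∈ Icc 0 τ, |(p a).derivative.eval t| ≤ D := fun a t ht => by
    have := hC (p a).derivative t ht
    rw [Real.norm_eq_abs] at this
    linarith [hDa a, le_abs_self (C (p a).derivative), abs_nonneg (C (p a))]
  let K : ℝ := (1 + M) * D ^ 2 * F.card * τ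
  have hK0 : 0 ≤ K := by positivity
  let ε : ℝ := 1 / (K + 1)
  have hε : 0 < ε := by positivity
  refine ⟨ε, fun ξ hξ hξ0 => ?_⟩
  set N : ℝ := ∑ a : F, ‖W a (ξ a)‖ ^ 2 with hN
  have hN0 : 0 < N := by
    obtain ⟨a, ha⟩ := Function.ne_iff.1 hξ0
    have hp : 0 < ‖W a (ξ a)‖ ^ 2 := by
      have : W a (ξ a) ≠ 0 := fun h =>
        ha (J.inj a (Ioo_subset_Icc_self (hF a a.2)) _ (hξ a) h)
      positivity
    exact hp.trans_le (Finset.single_le_sum (f := fun a : F => ‖W a (ξ a)‖ ^ 2)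
      (fun i _ => by positivity) (Finset.mem_univ a))
  let X : ℝ → E := fun t => ∑ a : F, cut a U (ξ a) t
  let X' : ℝ → E := fun t => ∑ a : F, cut a W (ξ a) t
  let Y : ℝ → E := fun t => ∑ a : F, (p a).eval t • (-(W a (ξ a)))
  let Y' : ℝ → E := fun t => ∑ a : F, (p a).derivative.eval t • (-(W a (ξ a)))
  have aX : Adm 0 τ X X' := Adm.sum _ fun a _ => cut_adm J (hF a a.2) (hξ a)
  have aY : Adm 0 τ Y Y' := Adm.sum _ fun a _ => Adm.of_hasDerivAt
    (fun t _ => ((p a).hasDerivAt t).smul_const _)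
    ((p a).derivative.continuous.continuousOn.smul continuousOn_const)
  have hX0 : X 0 = ∑ a : F, U 0 (ξ a) :=
    Finset.sum_congr rfl fun a _ => cut_of_le (hF a a.2).1.le _
  have hX0m : X 0 ∈ E₀ := by rw [hX0]; exact Submodule.sum_mem _ fun a _ => J.mem _
  have hY0 : Y 0 = 0 := Finset.sum_eq_zero fun a _ => by rw [h3, zero_smul]
  have hZ : (fun t => ∑ a : F, (cut a U (ξ a) t + (p a).eval t • ((-ε) • W a (ξ a)))) =
      fun t => X t + ε • Y t := by
    funext t
    simp only [X, Y]
    rw [Finset.smul_sum, ← Finset.sum_add_distrib]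
    refine Finset.sum_congr rfl fun a _ => ?_
    rw [smul_comm ε, smul_neg, neg_smul, smul_neg]
  rw [hZ, indexForm_eq hτ (aX.add (aY.smul ε))]
  -- the pairing with X
  have hpair : ∀ y y' : ℝ → E, Adm 0 τ y y' → y 0 ∈ E₀ →
      -(Q (X 0) (y 0)) + ∫ t in (0:ℝ)..τ, qb R X X' y y' t = ∑ a : F, ⟪W a (ξ a), y a⟫ := by
    intro y y' hy hy0
    have e1 : ∫ t in (0:ℝ)..τ, qb R X X' y y' t =
        ∑ a : F, ∫ t in (0:ℝ)..τ, qb R (cut a U (ξ a)) (cut a W (ξ a)) y y' t := by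
      rw [← intervalIntegral.integral_finsetSum]
      · apply intervalIntegral.integral_congr
        intro t _
        simp only [qb, X, X', map_sum, sum_inner, Finset.sum_sub_distrib]
      · intro a _
        exact (qb_bm hRcont (cut_adm J (hF a a.2) (hξ a)) hy).intervalIntegrable hτ.le
    rw [e1, hX0, map_sum, LinearMap.sum_apply, ← Finset.sum_neg_distrib, ← Finset.sum_add_distrib]
    exact Finset.sum_congr rfl fun a _ => cut_form J hRcont (hF a a.2) (hξ a) hy hy0
  have hXX := hpair X X' aX hX0m
  have hXY := hpair Y Y' aY (by rw [hY0]; exact E₀.zero_mem)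
  have hXX0 : ∑ a : F, ⟪W a (ξ a), X a⟫ = 0 := by
    refine Finset.sum_eq_zero fun a _ => ?_
    simp only [X]
    rw [inner_sum]
    refine Finset.sum_eq_zero fun b _ => ?_
    rcases le_total (a:ℝ) b with h | h
    · rw [cut_of_le h, ← J.lag a (Ioo_subset_Icc_self (hF a a.2)), hξ a, inner_zero_left]
    · rw [cut_of_ge h (hξ b), inner_zero_right]
  have hXY0 : ∑ a : F, ⟪W a (ξ a), Y a⟫ = -N := by
    rw [hN, ← Finset.sum_neg_distrib]
    refine Finset.sum_congr rfl fun a _ => ?_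
    have : Y a = -(W a (ξ a)) := by
      simp only [Y]
      rw [Finset.sum_eq_single a, h1, one_smul]
      · intro b _ hba
        rw [h2 b a hba.symm, zero_smul]
      · simp
    rw [this, inner_neg_right, real_inner_self_eq_norm_sq]
  rw [hXX0] at hXX
  rw [hXY0, hY0, map_zero, neg_zero, zero_add] at hXY
  have iXX := (qb_bm hRcont aX aX).intervalIntegrable hτ.le
  have iXY := (qb_bm hRcont aX aY).intervalIntegrable hτ.le
  have iYY := (qb_bm hRcont aY aY).intervalIntegrable hτ.le
  have hexp : ∫ t in (0:ℝ)..τ, qf R (fun t => X t + ε • Y t) (fun t => X' t + ε • Y' t) t =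
      (∫ t in (0:ℝ)..τ, qb R X X' X X' t) + (2 * ε) * (∫ t in (0:ℝ)..τ, qb R X X' Y Y' t)
        + ε ^ 2 * ∫ t in (0:ℝ)..τ, qb R Y Y' Y Y' t := by
    rw [← intervalIntegral.integral_const_mul, ← intervalIntegral.integral_const_mul,
      ← intervalIntegral.integral_add iXX (iXY.const_mul _),
      ← intervalIntegral.integral_add (iXX.add (iXY.const_mul _)) (iYY.const_mul _)]
    apply intervalIntegral.integral_congr
    intro t ht
    rw [uIcc_of_le hτ.le] at ht
    simp only [qf, qb, map_add, map_smul, inner_add_left, inner_add_right, inner_smul_left,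
      inner_smul_right, RCLike.conj_to_real]
    have e1 : ⟪R t (Y t), X t⟫ = ⟪R t (X t), Y t⟫ := by
      rw [hRsa t ht, real_inner_comm]
    rw [e1, real_inner_comm (X' t) (Y' t)]
    ring
  have hYY : ∫ t in (0:ℝ)..τ, qb R Y Y' Y Y' t ≤ K * N := by
    have hsum : (∑ a : F, ‖W a (ξ a)‖) ^ 2 ≤ F.card * N := by
      have := sq_sum_le_card_mul_sum_sq (s := (Finset.univ : Finset F)) (f := fun a => ‖W a (ξ a)‖)
      rw [Finset.card_univ, Fintype.card_coe] at this
      exact this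
    have hb : ∀ q : F → Polynomial ℝ, (∀ a, ∀ t ∈ Icc 0 τ, |(q a).eval t| ≤ D) → ∀ t ∈ Icc 0 τ,
        ‖∑ a : F, (q a).eval t • (-(W a (ξ a)))‖ ^ 2 ≤ D ^ 2 * (F.card * N) := by
      intro q hq t ht
      have : ‖∑ a : F, (q a).eval t • (-(W a (ξ a)))‖ ≤ D * ∑ a : F, ‖W a (ξ a)‖ := by
        rw [Finset.mul_sum]
        refine (norm_sum_le _ _).trans (Finset.sum_le_sum fun a _ => ?_)
        rw [norm_smul, norm_neg]
        gcongr
        exact hq a t ht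
      calc _ ≤ (D * ∑ a : F, ‖W a (ξ a)‖) ^ 2 := by gcongr
        _ = D ^ 2 * (∑ a : F, ‖W a (ξ a)‖) ^ 2 := by ring
        _ ≤ _ := by gcongr
    calc ∫ t in (0:ℝ)..τ, qb R Y Y' Y Y' t ≤ ∫ t in (0:ℝ)..τ, (1 + M) * (D ^ 2 * (F.card * N)) := by
          apply intervalIntegral.integral_mono_on hτ.le iYY (by simp)
          intro t ht
          have b1 := hb p hD1 t ht
          have b2 := hb (fun a => (p a).derivative) hD2 t ht
          have b3 : -⟪R t (Y t), Y t⟫ ≤ M * ‖Y t‖ ^ 2 := by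
            calc -⟪R t (Y t), Y t⟫ ≤ ‖R t (Y t)‖ * ‖Y t‖ :=
                  (neg_le_abs _).trans (abs_real_inner_le_norm _ _)
              _ ≤ (‖R t‖ * ‖Y t‖) * ‖Y t‖ := by gcongr; exact (R t).le_opNorm _
              _ ≤ (M * ‖Y t‖) * ‖Y t‖ := by
                gcongr
                exact hM t ht
              _ = _ := by ring
          have b4 : M * ‖Y t‖ ^ 2 ≤ M * (D ^ 2 * (F.card * N)) := by gcongr
          have b5 : ‖Y' t‖ ^ 2 ≤ D ^ 2 * (F.card * N) := b2
          rw [qb, real_inner_self_eq_norm_sq]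
          linarith
      _ = K * N := by
          rw [intervalIntegral.integral_const]
          simp only [smul_eq_mul, K]
          ring
  rw [hexp, hXY, hY0, smul_zero, add_zero]
  have hεK : ε * (K + 1) = 1 := by simp only [ε]; field_simp
  have : ε ^ 2 * ∫ t in (0:ℝ)..τ, qb R Y Y' Y Y' t ≤ ε ^ 2 * (K * N) := by gcongr
  have h7 : ε ^ 2 * (K * N) = ε * N * (1 - ε) := by
    have : ε * K = 1 - ε := by linarith
    calc _ = ε * N * (ε * K) := by ring
      _ = _ := by rw [this]
  have h8 : 0 < ε * N := by positivity
  have h9 : 0 < ε * N * ε := by positivity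
  nlinarith

theorem morse_lower [FiniteDimensional ℝ E] (J : JacobiPair τ R E₀ Q U W) (hτ : 0 < τ)
    (hRcont : ContinuousOn R (Icc 0 τ))
    (hRsa : ∀ t ∈ Set.Icc (0:ℝ) τ, ∀ u v : E, ⟪R t u, v⟫ = ⟪u, R t v⟫)
    (F : Finset ℝ) (hF : ∀ a ∈ F, a ∈ Ioo 0 τ) :
    ∑ a ∈ F, Module.finrank ℝ (LinearMap.ker (U a : E →ₗ[ℝ] E)) ∈ MorseIndexSet R E₀ Q τ := by
  classical
  choose p h1 h2 h3 h4 h5 using fun a : F => exists_psi F hF a a.2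
  obtain ⟨ε, hε⟩ := neg_form J hτ hRcont hRsa F hF p h1
    (fun a b hab => h2 a b b.2 (fun h => hab (Subtype.ext h))) h3
  let V := (a : F) → LinearMap.ker (U a : E →ₗ[ℝ] E)
  let b := Pi.basis (fun a : F => Module.finBasis ℝ (LinearMap.ker (U a : E →ₗ[ℝ] E)))
  have hcard : Fintype.card (Σ a : F, Fin (Module.finrank ℝ (LinearMap.ker (U a : E →ₗ[ℝ] E)))) =
      ∑ a ∈ F, Module.finrank ℝ (LinearMap.ker (U a : E →ₗ[ℝ] E)) := by
    rw [Fintype.card_sigma, ← Finset.sum_coe_sort F]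
    simp
  let σ := (Fintype.equivFinOfCardEq hcard).symm
  have hξ : ∀ i, ∃ a : F, ∃ x : LinearMap.ker (U a : E →ₗ[ℝ] E), b i = Pi.single a x := fun i =>
    ⟨i.1, _, Pi.basis_apply _ i⟩
  let Z : V → ℝ → E := fun ξ t =>
    ∑ a : F, (cut a U (ξ a : E) t + (p a).eval t • ((-ε) • W a (ξ a : E)))
  have hcut_add : ∀ (a t : ℝ) (x y : E), cut a U (x + y) t = cut a U x t + cut a U y t := by
    intro a t x y; unfold cut; split_ifs <;> simp
  have hcut_smul : ∀ (a t : ℝ) (c : ℝ) (x : E), cut a U (c • x) t = c • cut a U x t := by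
    intro a t x y; unfold cut; split_ifs <;> simp
  have hcut_zero : ∀ (a t : ℝ), cut a U (0:E) t = 0 := by
    intro a t; unfold cut; split_ifs <;> simp
  let Zl : ℝ → V →ₗ[ℝ] E := fun t =>
    { toFun := fun ξ => Z ξ t
      map_add' := by
        intro x y
        simp only [Z]
        rw [← Finset.sum_add_distrib]
        refine Finset.sum_congr rfl fun a _ => ?_
        have e : (((x + y) a : _) : E) = (x a : E) + (y a : E) := rfl
        rw [e, hcut_add, map_add, smul_add, smul_add]
        abel
      map_smul' := by
        intro c x
        simp only [Z, RingHom.id_apply]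
        rw [Finset.smul_sum]
        refine Finset.sum_congr rfl fun a _ => ?_
        have e : (((c • x) a : _) : E) = c • (x a : E) := rfl
        rw [e, hcut_smul, map_smul, smul_add, smul_comm (-ε) c, smul_comm _ c] }
  have hsum : ∀ (c : Fin _ → ℝ) (t : ℝ), ∑ i, c i • Z (b (σ i)) t = Z (∑ i, c i • b (σ i)) t := by
    intro c t
    change ∑ i, c i • Zl t (b (σ i)) = Zl t _
    rw [map_sum]
    simp only [map_smul]
  have hneg : ∀ c : Fin (∑ a ∈ F, Module.finrank ℝ (LinearMap.ker (U a : E →ₗ[ℝ] E))) → ℝ, c ≠ 0 →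
      indexForm R Q τ (fun t => ∑ i, c i • Z (b (σ i)) t) < 0 := by
    intro c hc
    simp only [hsum]
    apply hε (fun a => ((∑ i, c i • b (σ i) : V) a : E)) (fun a : F => ((∑ i, c i • b (σ i) : V) a).2)
    intro h
    apply hc
    have hz : ∑ i, c i • b (σ i) = 0 := by
      funext a
      exact Subtype.ext (congrFun h a)
    have hli := b.linearIndependent.comp σ σ.injective
    rw [Fintype.linearIndependent_iff] at hli
    funext i
    exact hli c hz i
  refine ⟨fun i => Z (b (σ i)), ?_, ?_, hneg⟩
  · intro i
    obtain ⟨a, x, hx⟩ := hξ (σ i)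
    have hZ : Z (b (σ i)) = fun t => cut a U (x : E) t + (p a).eval t • ((-ε) • W a (x : E)) := by
      funext t
      simp only [Z]
      rw [hx, Finset.sum_eq_single a]
      · simp
      · intro a' _ ha'
        simp [Pi.single_eq_of_ne ha', hcut_zero]
      · simp
    beta_reduce
    rw [hZ]
    exact z_inOmega J hRcont (hF a a.2) x.2 (p a) (h3 a) (h4 a) (h5 a) _
  · intro c hc
    by_contra hc0
    have := hneg c hc0
    have hA : Adm 0 τ (fun t => ∑ i, c i • Z (b (σ i)) t) (fun _ => (0:E)) := by
      refine ⟨continuousOn_const.congr hc, ∅, 0, finite_empty, le_rfl, ?_⟩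
      intro t ht
      refine ⟨(hasDerivAt_const t (0:E)).congr_of_eventuallyEq ?_, by simp⟩
      filter_upwards [Icc_mem_nhds ht.1.1 ht.1.2] with s hs using hc s hs
    rw [indexForm_eq hτ hA, hc 0 ⟨le_rfl, hτ.le⟩] at this
    have hz : ∫ t in (0:ℝ)..τ, qf R (fun t => ∑ i, c i • Z (b (σ i)) t) (fun _ => (0:E)) t = 0 := by
      refine (intervalIntegral.integral_congr (g := fun _ => 0) ?_).trans
        intervalIntegral.integral_zero
      intro t ht
      rw [uIcc_of_le hτ.le] at ht
      simp only [qf]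
      rw [hc t ht]
      simp
    rw [hz] at this
    simp at this

end PartI

end FileI

/-- **Morse index theorem (Hermann).** The Morse index of the index form `I` on
`Ω([0,τ],E)` is finite and equal to the sum of the multiplicities of the focal points
for `J = d²/dt² + R_t` and boundary condition `(E₀, Q)` contained in `(0,τ)`. -/
theorem morse_index_eq_sum_focal_multiplicities
    {E : Type*} [NormedAddCommGroup E] [InnerProductSpace ℝ E] [FiniteDimensional ℝ E]
    (τ : ℝ) (hτ : 0 < τ)
    (R : ℝ → E →L[ℝ] E) (hRcont : ContinuousOn R (Set.Icc 0 τ))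
    (hRsa : ∀ t ∈ Set.Icc (0:ℝ) τ, ∀ u v : E, ⟪R t u, v⟫ = ⟪u, R t v⟫)
    (E₀ : Submodule ℝ E) (Q : E →ₗ[ℝ] E →ₗ[ℝ] ℝ)
    (hQsymm : ∀ x ∈ E₀, ∀ y ∈ E₀, Q x y = Q y x) :
    BddAbove (MorseIndexSet R E₀ Q τ) ∧
    {a : ℝ | a ∈ Set.Ioo 0 τ ∧ IsFocalPoint R E₀ Q τ a}.Finite ∧
    sSup (MorseIndexSet R E₀ Q τ) =
      ∑ᶠ a ∈ {a : ℝ | a ∈ Set.Ioo 0 τ ∧ IsFocalPoint R E₀ Q τ a},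
        focalMultiplicity R E₀ Q a := by
  classical
  obtain ⟨U, W, J⟩ := exists_jacobiPair τ hτ R hRcont hRsa E₀ Q hQsymm
  have hfin : {a : ℝ | a ∈ Set.Ioo 0 τ ∧ IsFocalPoint R E₀ Q τ a}.Finite := by
    refine J.finite_singular.subset ?_
    rintro a ⟨ha, hfa⟩
    exact ⟨Set.Ioo_subset_Icc_self ha, ((J.isFocalPoint_iff hRcont).1 hfa).2⟩
  have hmem : ∀ a ∈ hfin.toFinset, a ∈ Set.Ioo 0 τ := fun a ha => (hfin.mem_toFinset.1 ha).1
  have hall : ∀ t ∈ Set.Ioo 0 τ, ¬ NonSing U t → t ∈ hfin.toFinset := by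
    intro t ht hn
    rw [hfin.mem_toFinset]
    refine ⟨ht, (J.isFocalPoint_iff hRcont).2 ⟨Set.Ioo_subset_Ioc_self ht, ?_⟩⟩
    unfold NonSing at hn
    push Not at hn
    obtain ⟨e, h1, h2⟩ := hn
    exact ⟨e, h2, h1⟩
  have hsum : (∑ᶠ a ∈ {a : ℝ | a ∈ Set.Ioo 0 τ ∧ IsFocalPoint R E₀ Q τ a},
      focalMultiplicity R E₀ Q a) =
      ∑ a ∈ hfin.toFinset, Module.finrank ℝ (LinearMap.ker (U a : E →ₗ[ℝ] E)) := by
    rw [finsum_mem_eq_finite_toFinset_sum _ hfin]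
    exact Finset.sum_congr rfl fun a ha =>
      J.focalMultiplicity_eq hRcont (Set.Ioo_subset_Ioc_self (hmem a ha))
  have hgr : IsGreatest (MorseIndexSet R E₀ Q τ)
      (∑ a ∈ hfin.toFinset, Module.finrank ℝ (LinearMap.ker (U a : E →ₗ[ℝ] E))) :=
    ⟨morse_lower J hτ hRcont hRsa _ hmem, fun n hn => morse_upper J hτ hRcont _ hall hn⟩
  exact ⟨⟨_, hgr.2⟩, hfin, by rw [hsum, hgr.csSup_eq]⟩
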